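/- arXiv:2206.02352 — 3 statements merged into one kernel-verified Lean document; each statement's English description precedes it below -/
import Mathlib

section
/- There exists a family (ζ_f)_{f ≥ 1}, indexed by the positive integers, with ζ_f ∈ F_{p^f}, such that: (i) for every f ≥ 1, ζ_f is a normal basis generator of F_{p^f} over F_p; and (ii) for all positive integers f', f with f' ∣ f, one has Tr_{F_{p^f}/F_{p^{f'}}}(ζ_f) = ζ_{f'}. -/
/-!
Fix a prime `p` and the algebraic closure of `𝔽_p`.  For each positive integer `f`,
`Fq p f` is the subfield `𝔽_{p^f} = {x | x ^ (p ^ f) = x}`, viewed as a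
`ZMod p`-submodule of the algebraic closure.  An element `ζ` is a normal basis
generator of `𝔽_{p^f}` over `𝔽_p` if its Frobenius orbit `(ζ, ζ^p, …, ζ^{p^{f-1}})`
is linearly independent over `𝔽_p` and spans `𝔽_{p^f}`.  For `f' ∣ f` the trace map
`Tr_{𝔽_{p^f}/𝔽_{p^{f'}}}` is `x ↦ ∑_{j < f/f'} x ^ (p ^ (f' * j))`.
-/

noncomputable section

/-- The subfield `𝔽_{p^f}` of the algebraic closure of `𝔽_p`, as a
`ZMod p`-submodule of the algebraic closure. -/
def Fq (p : ℕ) [Fact p.Prime] (f : ℕ) :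
    Submodule (ZMod p) (AlgebraicClosure (ZMod p)) where
  carrier := {x | x ^ p ^ f = x}
  add_mem' := by
    intro a b ha hb
    simp only [Set.mem_setOf_eq] at *
    rw [add_pow_char_pow, ha, hb]
  zero_mem' := by
    simp only [Set.mem_setOf_eq]
    exact zero_pow (pow_ne_zero _ (Fact.out (p := p.Prime)).ne_zero)
  smul_mem' := by
    intro c x hx
    simp only [Set.mem_setOf_eq] at *
    rw [Algebra.smul_def, mul_pow, hx, ← map_pow, ZMod.pow_card_pow]

/-- `ζ` is a normal basis generator of `𝔽_{p^f}` over `𝔽_p`:  the Frobenius orbit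
`(ζ, ζ^p, ζ^{p^2}, …, ζ^{p^{f-1}})` is an `𝔽_p`-basis of `𝔽_{p^f}`. -/
def IsNormalBasisGenerator (p : ℕ) [Fact p.Prime] (f : ℕ)
    (ζ : AlgebraicClosure (ZMod p)) : Prop :=
  LinearIndependent (ZMod p) (fun i : Fin f => ζ ^ p ^ (i : ℕ)) ∧
    Submodule.span (ZMod p) (Set.range fun i : Fin f => ζ ^ p ^ (i : ℕ)) = Fq p f

/-- The trace map `Tr_{𝔽_{p^f}/𝔽_{p^{f'}}}`, `x ↦ ∑_{j=0}^{f/f'-1} x ^ (p ^ (f' * j))`. -/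
def fieldTrace (p : ℕ) [Fact p.Prime] (f f' : ℕ) (x : AlgebraicClosure (ZMod p)) :
    AlgebraicClosure (ZMod p) :=
  ∑ j ∈ Finset.range (f / f'), x ^ p ^ (f' * j)

open Polynomial in
/-- The arithmetic Frobenius `x ↦ x ^ p` as an `𝔽_p`-linear endomorphism of the algebraic
closure of `𝔽_p`. -/
def frobLin (p : ℕ) [Fact p.Prime] : Module.End (ZMod p) (AlgebraicClosure (ZMod p)) :=
  (FiniteField.frobeniusAlgHom (ZMod p) (AlgebraicClosure (ZMod p))).toLinearMap

lemma frobLin_pow_apply (p : ℕ) [Fact p.Prime] (n : ℕ) (x : AlgebraicClosure (ZMod p)) :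
    (frobLin p ^ n) x = x ^ p ^ n := by
  induction n with
  | zero => simp
  | succ n ih =>
    rw [pow_succ', Module.End.mul_apply, ih, pow_succ, pow_mul]
    simp [frobLin, ZMod.card]

open Polynomial in
/-- The annihilator of `ζ` in `𝔽_p[X]`, with `X` acting as the Frobenius, is generated by
`X ^ f - 1`. -/
def HasFrobAnnihilator (p : ℕ) [Fact p.Prime] (f : ℕ) (ζ : AlgebraicClosure (ZMod p)) : Prop :=
  ∀ g : (ZMod p)[X], aeval (frobLin p) g ζ = 0 ↔ X ^ f - 1 ∣ g

open Polynomial in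
lemma exists_hasFrobAnnihilator (p : ℕ) [Fact p.Prime] {f : ℕ} (hf : f ≠ 0) :
    ∃ ζ, HasFrobAnnihilator p f ζ := by
  let L := GaloisField p f
  obtain ⟨x, hx⟩ := Module.exists_ker_toSpanSingleton_eq_annihilator (ZMod p)[X]
    (Module.AEval' (FiniteField.frobeniusAlgHom (ZMod p) L).toLinearMap)
  obtain ⟨x, rfl⟩ := (Module.AEval'.of _).surjective x
  rw [← span_minpoly_eq_annihilator, FiniteField.minpoly_frobeniusAlgHom,
    GaloisField.finrank p hf] at hx
  let i : L →ₐ[ZMod p] AlgebraicClosure (ZMod p) := IsAlgClosed.lift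
  have key (g : (ZMod p)[X]) (y : L) : aeval (frobLin p) g (i y) =
      i (aeval (FiniteField.frobeniusAlgHom (ZMod p) L).toLinearMap g y) := by
    induction g using Polynomial.induction_on generalizing y with
    | C a => simp
    | add g h hg hh => simp [hg, hh]
    | monomial n a h =>
      have hX : frobLin p (i y) = i ((FiniteField.frobeniusAlgHom (ZMod p) L) y) := by
        simp [frobLin]
      rw [pow_succ, ← mul_assoc, map_mul _ (C a * X ^ n) X, map_mul _ (C a * X ^ n) X,
        Module.End.mul_apply, Module.End.mul_apply, aeval_X, aeval_X, hX, h]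
      rfl
  refine ⟨i x, fun g => ?_⟩
  rw [key, map_eq_zero, ← Ideal.mem_span_singleton, ← hx, LinearMap.mem_ker,
    LinearMap.toSpanSingleton_apply, ← Module.AEval.of_aeval_smul, LinearEquiv.map_eq_zero_iff]
  rfl

open Polynomial in
lemma HasFrobAnnihilator.mem_Fq {p : ℕ} [Fact p.Prime] {f : ℕ} {ζ : AlgebraicClosure (ZMod p)}
    (h : HasFrobAnnihilator p f ζ) : ζ ∈ Fq p f := by
  have := (h (X ^ f - 1)).2 dvd_rfl
  change ζ ^ p ^ f = ζ
  simpa [frobLin_pow_apply, sub_eq_zero] using this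

lemma pow_mem_Fq {p : ℕ} [Fact p.Prime] {f : ℕ} {ζ : AlgebraicClosure (ZMod p)}
    (h : ζ ∈ Fq p f) (i : ℕ) : ζ ^ i ∈ Fq p f := by
  change (ζ ^ i) ^ p ^ f = ζ ^ i
  rw [pow_right_comm]
  exact congrArg (· ^ i) h

open Polynomial in
lemma finrank_Fq_le (p : ℕ) [Fact p.Prime] {f : ℕ} (hf : f ≠ 0) :
    Module.Finite (ZMod p) (Fq p f) ∧ Module.finrank (ZMod p) (Fq p f) ≤ f := by
  classical
  have hp : 1 < p := (Fact.out (p := p.Prime)).one_lt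
  have hne := FiniteField.X_pow_card_pow_sub_X_ne_zero (AlgebraicClosure (ZMod p)) hf hp
  have hsub : (Fq p f : Set (AlgebraicClosure (ZMod p))) ⊆
      ((X ^ p ^ f - X : (AlgebraicClosure (ZMod p))[X]).roots.toFinset : Set _) := by
    intro x hx
    have hx' : x ^ p ^ f = x := hx
    simp [hne, hx']
  have hfin : (Fq p f : Set (AlgebraicClosure (ZMod p))).Finite :=
    (Finset.finite_toSet _).subset hsub
  have : Finite (Fq p f) := hfin
  refine ⟨Module.Finite.of_finite, ?_⟩
  have hcard : Nat.card (Fq p f) ≤ p ^ f := by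
    calc Nat.card (Fq p f) = (Fq p f : Set (AlgebraicClosure (ZMod p))).ncard := rfl
      _ ≤ _ := Set.ncard_le_ncard hsub
      _ = _ := Set.ncard_coe_finset _
      _ ≤ _ := Multiset.toFinset_card_le _
      _ ≤ _ := card_roots' _
      _ = _ := FiniteField.X_pow_card_pow_sub_X_natDegree_eq _ hf hp
  rw [Module.natCard_eq_pow_finrank (K := ZMod p), Nat.card_zmod] at hcard
  exact (Nat.pow_le_pow_iff_right hp).1 hcard

open Polynomial in
lemma HasFrobAnnihilator.isNormalBasisGenerator {p : ℕ} [Fact p.Prime] {f : ℕ} (hf : f ≠ 0)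
    {ζ : AlgebraicClosure (ZMod p)} (h : HasFrobAnnihilator p f ζ) :
    IsNormalBasisGenerator p f ζ := by
  have hli : LinearIndependent (ZMod p) (fun i : Fin f => ζ ^ p ^ (i : ℕ)) := by
    rw [Fintype.linearIndependent_iff]
    intro c hc
    have hdeg : (∑ i : Fin f, C (c i) * X ^ (i : ℕ)).degree < (X ^ f - 1 : (ZMod p)[X]).degree := by
      rw [← C_1, degree_X_pow_sub_C (Nat.pos_of_ne_zero hf)]
      exact degree_sum_fin_lt c
    have h0 : ∑ i : Fin f, C (c i) * X ^ (i : ℕ) = 0 := by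
      refine eq_zero_of_dvd_of_degree_lt ((h _).1 ?_) hdeg
      rw [← hc]
      simp [frobLin_pow_apply, ← Algebra.smul_def]
    intro i
    have := congrArg (coeff · i) h0
    simpa [finsetSum_coeff, coeff_X_pow, Fin.val_inj] using this
  refine ⟨hli, ?_⟩
  obtain ⟨_, hle⟩ := finrank_Fq_le p hf
  refine Submodule.eq_of_le_of_finrank_le (Submodule.span_le.2 ?_) ?_
  · rintro _ ⟨i, rfl⟩
    exact pow_mem_Fq h.mem_Fq _
  · rw [finrank_span_eq_card hli, Fintype.card_fin]
    exact hle

open Polynomial in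
lemma HasFrobAnnihilator.exists_aeval_eq {p : ℕ} [Fact p.Prime] {f : ℕ} (hf : f ≠ 0)
    {ζ x : AlgebraicClosure (ZMod p)} (h : HasFrobAnnihilator p f ζ) (hx : x ∈ Fq p f) :
    ∃ u : (ZMod p)[X], aeval (frobLin p) u ζ = x := by
  rw [← (h.isNormalBasisGenerator hf).2, Submodule.mem_span_range_iff_exists_fun] at hx
  obtain ⟨c, rfl⟩ := hx
  exact ⟨∑ i : Fin f, C (c i) * X ^ (i : ℕ), by
    simp [frobLin_pow_apply, ← Algebra.smul_def]⟩

lemma exists_isCoprime_add_mul {R : Type*} [CommRing R] [IsDomain R] [IsPrincipalIdealRing R]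
    {u a c : R} (h : IsCoprime u a) (hc : c ≠ 0) : ∃ t, IsCoprime (u + a * t) c := by
  induction c using UniqueFactorizationMonoid.induction_on_prime with
  | h₁ => exact absurd rfl hc
  | h₂ c hu =>
    obtain ⟨v, hv⟩ := hu.exists_left_inv
    exact ⟨0, 0, v, by simpa using hv⟩
  | h₃ c q hc0 hq ih =>
    obtain ⟨t, ht⟩ := ih hc0
    by_cases hd : q ∣ u + a * t
    · have hqc : ¬ q ∣ c := fun hq' => hq.not_isUnit (ht.isUnit_of_dvd' hd hq')
      have hqa : ¬ q ∣ a := fun hq' => hq.not_isUnit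
        (h.isUnit_of_dvd' ((dvd_add_left (hq'.mul_right t)).1 hd) hq')
      refine ⟨t + c, IsCoprime.mul_right ?_ ?_⟩
      · refine ((hq.irreducible.coprime_iff_not_dvd).2 fun hq' => ?_).symm
        rw [mul_add, ← add_assoc, dvd_add_right hd] at hq'
        exact (hq.dvd_or_dvd hq').elim hqa hqc
      · rw [mul_add, ← add_assoc]
        exact ht.add_mul_right_left a
    · exact ⟨t, (((hq.irreducible.coprime_iff_not_dvd).2 hd).symm).mul_right ht⟩

open Polynomial in
/-- The polynomial in the Frobenius giving the trace from `𝔽_{p^f}` to `𝔽_{p^f'}`. -/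
def tracePoly (p f f' : ℕ) : (ZMod p)[X] := ∑ j ∈ Finset.range (f / f'), X ^ (f' * j)

open Polynomial in
lemma fieldTrace_eq_aeval (p : ℕ) [Fact p.Prime] (f f' : ℕ) (x : AlgebraicClosure (ZMod p)) :
    fieldTrace p f f' x = aeval (frobLin p) (tracePoly p f f') x := by
  simp [fieldTrace, tracePoly, frobLin_pow_apply]

open Polynomial in
lemma tracePoly_mul (p : ℕ) {f f' : ℕ} (h : f' ∣ f) :
    tracePoly p f f' * (X ^ f' - 1) = X ^ f - 1 := by
  simp_rw [tracePoly, pow_mul]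
  rw [geom_sum_mul, ← pow_mul, Nat.mul_div_cancel' h]

open Polynomial in
lemma zmod_X_pow_sub_one_ne_zero (p : ℕ) [Fact p.Prime] {f : ℕ} (hf : f ≠ 0) :
    (X ^ f - 1 : (ZMod p)[X]) ≠ 0 :=
  (monic_X_pow_sub_C 1 hf).ne_zero

lemma fieldTrace_fieldTrace (p : ℕ) [Fact p.Prime] {f f' f'' : ℕ} (hf : f'' ≠ 0)
    (h : f' ∣ f) (h' : f'' ∣ f') (x : AlgebraicClosure (ZMod p)) :
    fieldTrace p f' f'' (fieldTrace p f f' x) = fieldTrace p f f'' x := by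
  simp_rw [fieldTrace_eq_aeval]
  rw [← Module.End.mul_apply, ← map_mul]
  congr 2
  apply mul_right_cancel₀ (zmod_X_pow_sub_one_ne_zero p hf)
  rw [mul_right_comm, tracePoly_mul p h', mul_comm, tracePoly_mul p h,
    tracePoly_mul p (h'.trans h)]

lemma HasFrobAnnihilator.fieldTrace {p : ℕ} [Fact p.Prime] {f f' : ℕ} (hf : f ≠ 0)
    (hd : f' ∣ f) {ζ : AlgebraicClosure (ZMod p)} (h : HasFrobAnnihilator p f ζ) :
    HasFrobAnnihilator p f' (fieldTrace p f f' ζ) := by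
  intro g
  have h0 : tracePoly p f f' ≠ 0 :=
    left_ne_zero_of_mul (tracePoly_mul p hd ▸ zmod_X_pow_sub_one_ne_zero p hf)
  rw [fieldTrace_eq_aeval, ← Module.End.mul_apply, ← map_mul, h, ← tracePoly_mul p hd,
    mul_comm g, mul_dvd_mul_iff_left h0]

open Polynomial in
lemma HasFrobAnnihilator.exists_fieldTrace_eq {p : ℕ} [Fact p.Prime] {f f' : ℕ} (hf : f ≠ 0)
    (hd : f' ∣ f) {x : AlgebraicClosure (ZMod p)} (hx : HasFrobAnnihilator p f' x) :
    ∃ ζ, HasFrobAnnihilator p f ζ ∧ _root_.fieldTrace p f f' ζ = x := by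
  have hf' : f' ≠ 0 := ne_zero_of_dvd_ne_zero hf hd
  obtain ⟨z, hz⟩ := exists_hasFrobAnnihilator p hf
  have hy := hz.fieldTrace hf hd
  obtain ⟨u, hu⟩ := hy.exists_aeval_eq hf' hx.mem_Fq
  obtain ⟨v, hv⟩ := hx.exists_aeval_eq hf' hy.mem_Fq
  have hco : IsCoprime u (X ^ f' - 1) := by
    obtain ⟨w, hw⟩ := (hy (v * u - 1)).1 (by
      rw [map_sub, map_mul, LinearMap.sub_apply, Module.End.mul_apply, hu, hv]; simp)
    exact ⟨v, -w, by linear_combination hw⟩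
  obtain ⟨t, ht⟩ := exists_isCoprime_add_mul hco (zmod_X_pow_sub_one_ne_zero p hf)
  refine ⟨aeval (frobLin p) (u + (X ^ f' - 1) * t) z, fun g => ?_, ?_⟩
  · rw [← Module.End.mul_apply, ← map_mul, hz]
    exact ⟨ht.symm.dvd_of_dvd_mul_right, fun h => h.mul_right _⟩
  · have h1 := (hy ((X ^ f' - 1) * t)).2 (dvd_mul_right _ _)
    rw [fieldTrace_eq_aeval, ← Module.End.mul_apply, ← map_mul, mul_comm, map_mul,
      Module.End.mul_apply, ← fieldTrace_eq_aeval, map_add, LinearMap.add_apply, hu, h1, add_zero]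

/-- A family of normal basis generators along the factorials, compatible with traces. -/
lemma exists_factorial_seq (p : ℕ) [Fact p.Prime] :
    ∃ a : ℕ → AlgebraicClosure (ZMod p), (∀ n, HasFrobAnnihilator p n.factorial (a n)) ∧
      ∀ n, fieldTrace p (n + 1).factorial n.factorial (a (n + 1)) = a n := by
  choose g hg hg' using fun (n : ℕ) (x : {x // HasFrobAnnihilator p n.factorial x}) =>
    x.2.exists_fieldTrace_eq (n + 1).factorial_ne_zero
      (Nat.factorial_dvd_factorial n.le_succ)
  let a₀ : {x // HasFrobAnnihilator p (Nat.factorial 0) x} :=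
    ⟨_, (exists_hasFrobAnnihilator p (Nat.factorial_ne_zero 0)).choose_spec⟩
  let a (n : ℕ) : {x // HasFrobAnnihilator p n.factorial x} :=
    Nat.rec a₀ (fun n x => ⟨g n x, hg n x⟩) n
  exact ⟨fun n => (a n).1, fun n => (a n).2, fun n => hg' n (a n)⟩

lemma fieldTrace_factorial_of_le {p : ℕ} [Fact p.Prime] {a : ℕ → AlgebraicClosure (ZMod p)}
    (ha : ∀ n, fieldTrace p (n + 1).factorial n.factorial (a (n + 1)) = a n) {m n : ℕ}
    (h : m ≤ n) : fieldTrace p n.factorial m.factorial (a n) = a m := by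
  induction n, h using Nat.le_induction with
  | base => simp [fieldTrace, Nat.div_self m.factorial_pos]
  | succ n h ih =>
    rw [← fieldTrace_fieldTrace p m.factorial_ne_zero
      (Nat.factorial_dvd_factorial n.le_succ) (Nat.factorial_dvd_factorial h), ha, ih]

/-- There exists a family `(ζ_f)_{f ≥ 1}` with `ζ_f ∈ 𝔽_{p^f}` such that each `ζ_f`
is a normal basis generator of `𝔽_{p^f}` over `𝔽_p`, and for all `f' ∣ f` one has
`Tr_{𝔽_{p^f}/𝔽_{p^{f'}}}(ζ_f) = ζ_{f'}`. -/
theorem exists_compatible_normal_basis_generators (p : ℕ) [Fact p.Prime] :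
    ∃ ζ : ℕ → AlgebraicClosure (ZMod p),
      (∀ f : ℕ, 0 < f → IsNormalBasisGenerator p f (ζ f)) ∧
      (∀ f' f : ℕ, 0 < f' → 0 < f → f' ∣ f → fieldTrace p f f' (ζ f) = ζ f') := by
  obtain ⟨a, ha, ha'⟩ := exists_factorial_seq p
  refine ⟨fun f => fieldTrace p f.factorial f (a f), fun f hf => ?_, fun f' f hf' hf hd => ?_⟩
  · exact ((ha f).fieldTrace f.factorial_ne_zero
      (Nat.dvd_factorial hf le_rfl)).isNormalBasisGenerator hf.ne'
  · have hle := Nat.le_of_dvd hf hd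
    change fieldTrace p f f' (fieldTrace p f.factorial f (a f)) =
      fieldTrace p f'.factorial f' (a f')
    rw [fieldTrace_fieldTrace p hf'.ne' (Nat.dvd_factorial hf le_rfl) hd,
      ← fieldTrace_factorial_of_le ha' hle,
      fieldTrace_fieldTrace p hf'.ne' (Nat.factorial_dvd_factorial hle)
        (Nat.dvd_factorial hf' le_rfl)]
end
end

section
/- There exists a family (ζ_f)_{f ≥ 1}, indexed by the positive integers, such that each ζ_f ∈ W(F_{p^f}) is a Teichmüller representative and: (i) for every f ≥ 1, the Frobenius orbit (ζ_f, φ(ζ_f), …, φ^{f−1}(ζ_f)) is a ℤ_p-basis of W(F_{p^f}) (i.e., ζ_f is a basis of the ring of integers of ℚ_{p^f} as a module over ℤ_p[Gal(ℚ_{p^f}/ℚ_p)]); and (ii) for all f' ∣ f there exist a_0, a_1, …, a_{f'−1} ∈ ℤ_p with a_0 ≡ 1 (mod p) and a_i ≡ 0 (mod p) for 1 ≤ i ≤ f'−1, such that Tr_{f/f'}(ζ_f) = Σ_{i=0}^{f'−1} a_i · φ^i(ι(ζ_{f'})), where ι : W(F_{p^{f'}}) → W(F_{p^f}) is the functorial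 injection. (In particular the element α_{f/f'} = Σ_i a_i σ^i is a unit of the group ring ℤ_p[Gal(ℚ_{p^{f'}}/ℚ_p)], being congruent to 1 modulo p.) -/
/-!
Fix a prime `p`.  For each positive integer `f`, `Fqf p f` is the subfield
`𝔽_{p^f} = {x | x ^ (p ^ f) = x}` of the algebraic closure of `𝔽_p`, and
`WittVector p (Fqf p f)` is the ring of `p`-typical Witt vectors `W(𝔽_{p^f})`, i.e. the
ring of integers of the unramified extension `ℚ_{p^f}/ℚ_p`.  Its `ℤ_p`-algebra structure
comes from the canonical isomorphism `ℤ_p ≅ W(𝔽_p)` followed by functoriality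
(`padicToWittFq`), `φ` is the Witt vector Frobenius, `Tr_{f/f'} = ∑_{j<f/f'} φ^{f'·j}`
is the trace (`wittTrace`), and for `f' ∣ f` the functorial injection
`W(𝔽_{p^{f'}}) → W(𝔽_{p^f})` is `WittVector.map` of the subfield inclusion.
"Basis" statements are phrased as unique representability.
-/

noncomputable section

/-- The subfield `𝔽_{p^f}` of the algebraic closure of `𝔽_p`. -/
def Fqf (p : ℕ) [Fact p.Prime] (f : ℕ) : Subfield (AlgebraicClosure (ZMod p)) where
  carrier := {x | x ^ p ^ f = x}
  mul_mem' := by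
    intro a b ha hb
    simp only [Set.mem_setOf_eq] at *
    rw [mul_pow, ha, hb]
  one_mem' := by simp
  add_mem' := by
    intro a b ha hb
    simp only [Set.mem_setOf_eq] at *
    rw [add_pow_char_pow, ha, hb]
  zero_mem' := by
    simp only [Set.mem_setOf_eq]
    exact zero_pow (pow_ne_zero _ (Fact.out (p := p.Prime)).ne_zero)
  neg_mem' := by
    intro a ha
    simp only [Set.mem_setOf_eq] at *
    rw [neg_pow, ha, neg_one_pow_char_pow]
    ring
  inv_mem' := by
    intro a ha
    simp only [Set.mem_setOf_eq] at *
    rw [inv_pow, ha]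

lemma mem_Fqf {p : ℕ} [Fact p.Prime] {f : ℕ} {x : AlgebraicClosure (ZMod p)} :
    x ∈ Fqf p f ↔ x ^ p ^ f = x := Iff.rfl

lemma Fqf_le (p : ℕ) [Fact p.Prime] {f' f : ℕ} (h : f' ∣ f) : Fqf p f' ≤ Fqf p f := by
  intro x hx
  rw [mem_Fqf] at hx ⊢
  obtain ⟨k, rfl⟩ := h
  rw [pow_mul]
  induction k with
  | zero => simp
  | succ k ih => rw [pow_succ, pow_mul, ih, hx]

/-- The canonical ring map `ℤ_p → W(𝔽_{p^f})`, obtained from the canonical isomorphism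
`ℤ_p ≅ W(𝔽_p)` followed by the functorial map `W(𝔽_p) → W(𝔽_{p^f})`. -/
def padicToWittFq (p : ℕ) [Fact p.Prime] (f : ℕ) :
    ℤ_[p] →+* WittVector p (Fqf p f) :=
  (WittVector.map (ZMod.castHom (dvd_refl p) (Fqf p f))).comp
    (WittVector.equiv p).symm.toRingHom

/-- The trace `Tr_{f/f'} = ∑_{j=0}^{f/f'-1} φ^{f'·j} : W(𝔽_{p^f}) → W(𝔽_{p^f})`,
where `φ` is the Witt vector Frobenius. -/
def wittTrace (p : ℕ) [Fact p.Prime] (f f' : ℕ) (x : WittVector p (Fqf p f)) :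
    WittVector p (Fqf p f) :=
  ∑ j ∈ Finset.range (f / f'),
    (⇑(WittVector.frobenius :
        WittVector p (Fqf p f) →+* WittVector p (Fqf p f)))^[f' * j] x


open Polynomial in
lemma Fqf_card (p : ℕ) [Fact p.Prime] {f : ℕ} (hf : 0 < f) : Nat.card (Fqf p f) = p ^ f := by
  have hp : 1 < p := (Fact.out : p.Prime).one_lt
  set g : (ZMod p)[X] := X ^ p ^ f - X
  have hg : g ≠ 0 := FiniteField.X_pow_card_pow_sub_X_ne_zero _ hf.ne' hp
  have hset : (Fqf p f : Set (AlgebraicClosure (ZMod p)))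
      = g.rootSet (AlgebraicClosure (ZMod p)) := by
    ext x
    simp [mem_rootSet_of_ne hg, g, sub_eq_zero, mem_Fqf]
  have key : Fintype.card (g.rootSet (AlgebraicClosure (ZMod p))) = g.natDegree :=
    card_rootSet_eq_natDegree (galois_poly_separable p _ (dvd_pow (dvd_refl p) hf.ne'))
      (IsAlgClosed.splits _)
  rw [FiniteField.X_pow_card_pow_sub_X_natDegree_eq _ hf.ne' hp] at key
  rw [← key, ← Nat.card_eq_fintype_card, ← hset]
  rfl

lemma Fqf_finite (p : ℕ) [Fact p.Prime] {f : ℕ} (hf : 0 < f) : Finite (Fqf p f) :=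
  Nat.finite_of_card_ne_zero <| by
    rw [Fqf_card p hf]
    exact pow_ne_zero _ (Fact.out : p.Prime).ne_zero

instance Fqf_algebra (p : ℕ) [Fact p.Prime] (f : ℕ) : Algebra (ZMod p) (Fqf p f) :=
  ZMod.algebra _ p

instance Fqf_module (p : ℕ) [Fact p.Prime] (f : ℕ) : Module (ZMod p) (Fqf p f) :=
  Algebra.toModule

/-- The `p`-power Frobenius of the algebraic closure of `𝔽_p`, as an `𝔽_p`-linear map. -/
def frobEnd (p : ℕ) [Fact p.Prime] : Module.End (ZMod p) (AlgebraicClosure (ZMod p)) :=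
  (FiniteField.frobeniusAlgHom (ZMod p) (AlgebraicClosure (ZMod p))).toLinearMap

lemma frobEnd_pow_apply (p : ℕ) [Fact p.Prime] (n : ℕ) (x : AlgebraicClosure (ZMod p)) :
    (frobEnd p ^ n) x = x ^ p ^ n := by
  induction n with
  | zero => simp
  | succ n ih =>
    rw [pow_succ', Module.End.mul_apply, ih, pow_succ, pow_mul]
    simp [frobEnd]

/-- The trace from `𝔽_{p^f}` to `𝔽_{p^f'}`, as an endomorphism of the algebraic closure. -/
def frobTrace (p : ℕ) [Fact p.Prime] (f' f : ℕ) :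
    Module.End (ZMod p) (AlgebraicClosure (ZMod p)) :=
  ∑ j ∈ Finset.range (f / f'), (frobEnd p ^ f') ^ j

lemma frobTrace_apply (p : ℕ) [Fact p.Prime] (f' f : ℕ) (x : AlgebraicClosure (ZMod p)) :
    frobTrace p f' f x = ∑ j ∈ Finset.range (f / f'), x ^ p ^ (f' * j) := by
  simp only [frobTrace, LinearMap.sum_apply, ← pow_mul, frobEnd_pow_apply]

lemma frobTrace_self (p : ℕ) [Fact p.Prime] {f : ℕ} (hf : 0 < f) : frobTrace p f f = 1 := by
  simp [frobTrace, Nat.div_self hf]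

lemma geom_sum_mul_geom_sum_pow {R : Type*} [Semiring R] (x : R) (m n : ℕ) :
    (∑ i ∈ Finset.range m, x ^ i) * ∑ j ∈ Finset.range n, (x ^ m) ^ j
      = ∑ k ∈ Finset.range (m * n), x ^ k := by
  induction n with
  | zero => simp
  | succ n ih =>
    rw [Finset.sum_range_succ, mul_add, ih, Nat.mul_succ, Finset.sum_range_add, ← pow_mul,
      Finset.sum_mul]
    simp only [← pow_add, add_comm]

lemma frobTrace_trans (p : ℕ) [Fact p.Prime] {a b c : ℕ} (ha : 0 < a) (hb : 0 < b)
    (hab : a ∣ b) (hbc : b ∣ c) (x : AlgebraicClosure (ZMod p)) :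
    frobTrace p a b (frobTrace p b c x) = frobTrace p a c x := by
  obtain ⟨m, rfl⟩ := hab
  obtain ⟨n, rfl⟩ := hbc
  rw [← Module.End.mul_apply]
  simp only [frobTrace]
  rw [Nat.mul_div_cancel_left _ ha, Nat.mul_div_cancel_left _ hb, mul_assoc,
    Nat.mul_div_cancel_left _ ha, ← geom_sum_mul_geom_sum_pow, pow_mul]

lemma mem_Fqf_iff_frobEnd {p : ℕ} [Fact p.Prime] {f : ℕ} {x : AlgebraicClosure (ZMod p)} :
    x ∈ Fqf p f ↔ (frobEnd p ^ f - 1) x = 0 := by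
  rw [LinearMap.sub_apply, frobEnd_pow_apply, Module.End.one_apply, sub_eq_zero, mem_Fqf]

lemma frobEnd_sub_one_frobTrace (p : ℕ) [Fact p.Prime] {f' f : ℕ} (h : f' ∣ f)
    (x : AlgebraicClosure (ZMod p)) :
    (frobEnd p ^ f' - 1) (frobTrace p f' f x) = (frobEnd p ^ f - 1) x := by
  rw [← Module.End.mul_apply, frobTrace, mul_geom_sum, ← pow_mul, Nat.mul_div_cancel' h]

lemma frobTrace_mem (p : ℕ) [Fact p.Prime] {f' f : ℕ} (h : f' ∣ f)
    {x : AlgebraicClosure (ZMod p)} : frobTrace p f' f x ∈ Fqf p f' ↔ x ∈ Fqf p f := by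
  rw [mem_Fqf_iff_frobEnd, mem_Fqf_iff_frobEnd, frobEnd_sub_one_frobTrace p h]

open Polynomial in
lemma frobTrace_surjective (p : ℕ) [Fact p.Prime] {f' f : ℕ} (hf' : 0 < f') (hf : 0 < f)
    (h : f' ∣ f) : Function.Surjective (frobTrace p f' f) := by
  intro y
  obtain ⟨m, rfl⟩ := h
  obtain ⟨m, rfl⟩ := Nat.exists_eq_succ_of_ne_zero (Nat.pos_of_mul_pos_left hf).ne'
  have hp : 1 < p := (Fact.out : p.Prime).one_lt
  set g : (AlgebraicClosure (ZMod p))[X] :=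
    ∑ j ∈ Finset.range (m + 1), X ^ p ^ (f' * j) - C y with hgdef
  have hcoeff : g.coeff (p ^ (f' * m)) ≠ 0 := by
    have : ∀ j ∈ Finset.range (m + 1),
        (if p ^ (f' * m) = p ^ (f' * j) then (1 : AlgebraicClosure (ZMod p)) else 0)
          = if m = j then 1 else 0 := by
      intro j _
      congr 1
      rw [Nat.pow_right_inj hp, Nat.mul_right_inj hf'.ne']
    simp [hgdef, coeff_X_pow, coeff_C, (Fact.out : p.Prime).ne_zero, Finset.sum_congr rfl this]
  have hdeg : g.degree ≠ 0 := by
    intro h0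
    refine hcoeff (coeff_eq_zero_of_degree_lt ?_)
    rw [h0]
    exact_mod_cast pow_pos (by omega : 0 < p) _
  obtain ⟨x, hx⟩ := IsAlgClosed.exists_root g hdeg
  refine ⟨x, ?_⟩
  rw [frobTrace_apply, Nat.mul_div_cancel_left _ hf']
  simpa [hgdef, eval_finsetSum, sub_eq_zero] using hx

/-- `u` generates a normal basis of `𝔽_{p^f}` over `𝔽_p`. -/
def IsNormalGen (p : ℕ) [Fact p.Prime] (f : ℕ) (u : AlgebraicClosure (ZMod p)) : Prop :=
  u ∈ Fqf p f ∧ ∀ y ∈ Fqf p f,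
    y ∈ Submodule.span (ZMod p) (Set.range fun i : ℕ => u ^ p ^ i)

lemma exists_isNormalGen (p : ℕ) [Fact p.Prime] {f : ℕ} (hf : 0 < f) :
    ∃ u, IsNormalGen p f u := by
  have := Fqf_finite p hf
  set b := IsGalois.normalBasis (ZMod p) (Fqf p f)
  refine ⟨b 1, (b 1).2, fun y hy => ?_⟩
  let ι : Fqf p f →ₐ[ZMod p] AlgebraicClosure (ZMod p) :=
    { (Fqf p f).subtype with
      commutes' := RingHom.congr_fun (Subsingleton.elim
        ((Fqf p f).subtype.comp (algebraMap (ZMod p) (Fqf p f)))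
        (algebraMap (ZMod p) (AlgebraicClosure (ZMod p)))) }
  have hmem : (⟨y, hy⟩ : Fqf p f) ∈ Submodule.span (ZMod p) (Set.range b) := by
    rw [b.span_eq]; trivial
  have := Submodule.mem_map_of_mem (f := ι.toLinearMap) hmem
  rw [Submodule.map_span] at this
  refine Submodule.span_mono ?_ this
  rintro _ ⟨_, ⟨σ, rfl⟩, rfl⟩
  obtain ⟨n, rfl⟩ := (FiniteField.bijective_frobeniusAlgEquivOfAlgebraic_pow
    (ZMod p) (Fqf p f)).2 σ
  refine ⟨n, ?_⟩
  have h1 := IsGalois.normalBasis_apply (K := ZMod p) (L := Fqf p f)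
    (FiniteField.frobeniusAlgEquivOfAlgebraic (ZMod p) (Fqf p f) ^ n.1)
  change b _ = _ at h1
  simp only [h1, AlgEquiv.coe_pow, FiniteField.coe_frobeniusAlgEquivOfAlgebraic_iterate, ZMod.card]
  rfl

lemma IsNormalGen.frobTrace {p : ℕ} [Fact p.Prime] {f' f : ℕ} (hf' : 0 < f') (hf : 0 < f)
    (h : f' ∣ f) {u : AlgebraicClosure (ZMod p)} (hu : IsNormalGen p f u) :
    IsNormalGen p f' (frobTrace p f' f u) := by
  refine ⟨(frobTrace_mem p h).2 hu.1, fun y hy => ?_⟩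
  obtain ⟨x, rfl⟩ := frobTrace_surjective p hf' hf h y
  have := Submodule.mem_map_of_mem (f := _root_.frobTrace p f' f)
    (hu.2 x ((frobTrace_mem p h).1 hy))
  rw [Submodule.map_span] at this
  refine Submodule.span_mono ?_ this
  rintro _ ⟨_, ⟨i, rfl⟩, rfl⟩
  refine ⟨i, ?_⟩
  have hc : Commute (frobEnd p ^ i) (_root_.frobTrace p f' f) :=
    Commute.sum_right _ _ _ fun j _ => by
      rw [← pow_mul]
      exact Commute.pow_pow_self _ _ _
  simp only [← frobEnd_pow_apply, ← Module.End.mul_apply, hc.eq]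

open CategoryTheory in
lemma exists_compatible_isNormalGen (p : ℕ) [Fact p.Prime] :
    ∃ u : ℕ → AlgebraicClosure (ZMod p), (∀ f, 0 < f → IsNormalGen p f (u f)) ∧
      ∀ f' f, 0 < f' → 0 < f → f' ∣ f → frobTrace p f' f (u f) = u f' := by
  let F : ℕᵒᵖ ⥤ Type :=
    { obj := fun n => {u // IsNormalGen p (n.unop.factorial) u}
      map := fun {a b} g => TypeCat.ofHom fun u => ⟨frobTrace p _ _ u.1,
        u.2.frobTrace (Nat.factorial_pos _) (Nat.factorial_pos _)
          (Nat.factorial_dvd_factorial (leOfHom g.unop))⟩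
      map_id := by
        intro a
        ext u
        simp [frobTrace_self p (Nat.factorial_pos _)]
      map_comp := by
        intro a b c g h
        ext u
        simp [frobTrace_trans p (Nat.factorial_pos _) (Nat.factorial_pos _)
          (Nat.factorial_dvd_factorial (leOfHom h.unop))
          (Nat.factorial_dvd_factorial (leOfHom g.unop))] }
  have hfin : ∀ n, Finite (F.obj n) := fun n =>
    have := Fqf_finite p (Nat.factorial_pos n.unop)
    Finite.of_injective (β := Fqf p n.unop.factorial) (fun u => ⟨u.1, u.2.1⟩)
      fun u v huv => Subtype.ext (congrArg (fun z : Fqf p n.unop.factorial => z.1) huv)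
  have hne : ∀ n, Nonempty (F.obj n) := fun n =>
    let ⟨u, hu⟩ := exists_isNormalGen p (Nat.factorial_pos n.unop)
    ⟨⟨u, hu⟩⟩
  obtain ⟨s, hs⟩ := nonempty_sections_of_finite_inverse_system F
  let v : ℕ → AlgebraicClosure (ZMod p) := fun n => (s (Opposite.op n)).1
  have hv : ∀ n, IsNormalGen p n.factorial (v n) := fun n => (s (Opposite.op n)).2
  have hvt : ∀ m n, m ≤ n → frobTrace p m.factorial n.factorial (v n) = v m := fun m n h =>
    congrArg Subtype.val (hs (homOfLE h).op)
  refine ⟨fun f => frobTrace p f f.factorial (v f), fun f hf =>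
    (hv f).frobTrace hf (Nat.factorial_pos _) (Nat.dvd_factorial hf le_rfl),
    fun f' f hf' hf h => ?_⟩
  have hle := Nat.le_of_dvd hf h
  beta_reduce
  rw [frobTrace_trans p hf' hf h (Nat.dvd_factorial hf le_rfl), ← hvt f' f hle,
    frobTrace_trans p hf' (Nat.factorial_pos _) (Nat.dvd_factorial hf' le_rfl)
      (Nat.factorial_dvd_factorial hle)]

open Ideal in
/-- Successive approximation: over a `p`-adically complete ring, a family that generates a
`p`-adically separated algebra modulo `p` generates it. -/
lemma exists_eq_sum_of_exists_eq_sum_add_mul {A B ι : Type*} [CommRing A] [CommRing B] [Fintype ι]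
    (p : ℕ) [IsPrecomplete (span {(p : A)}) A] [IsHausdorff (span {(p : B)}) B]
    (g : A →+* B) (b : ι → B)
    (hb : ∀ x, ∃ (c : ι → A) (y : B), x = ∑ i, g (c i) * b i + p * y) (x : B) :
    ∃ c : ι → A, x = ∑ i, g (c i) * b i := by
  choose c r hcr using hb
  let s : ℕ → ι → A := fun n i => ∑ k ∈ Finset.range n, p ^ k * c (r^[k] x) i
  have hs : ∀ n, x = ∑ i, g (s n i) * b i + p ^ n * r^[n] x := by
    intro n
    induction n with
    | zero => simp [s]
    | succ n ih =>
      conv_lhs => rw [ih, hcr (r^[n] x)]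
      simp only [s, Finset.sum_range_succ, map_add, map_mul, map_pow, map_natCast, add_mul,
        Finset.sum_add_distrib, Function.iterate_succ_apply', mul_add, Finset.mul_sum]
      simp only [mul_assoc, pow_succ, add_assoc]
  have hcauchy : ∀ i, ∃ L : A, ∀ n, s n i ≡ L [SMOD (span {(p : A)} ^ n • ⊤ : Submodule A A)] := by
    intro i
    refine IsPrecomplete.prec' _ fun {m n} hmn => ?_
    rw [SModEq.comm, SModEq.sub_mem, span_singleton_pow, smul_eq_mul, mul_top,
      mem_span_singleton]
    simp only [s, Finset.sum_range_sub_sum_range hmn]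
    refine Finset.dvd_sum fun k hk => ?_
    exact Dvd.dvd.mul_right (pow_dvd_pow _ (Finset.mem_filter.1 hk).2) _
  choose L hL using hcauchy
  refine ⟨L, IsHausdorff.eq_iff_smodEq (I := span {(p : B)}) |>.2 fun n => ?_⟩
  rw [SModEq.sub_mem, span_singleton_pow, smul_eq_mul, mul_top, mem_span_singleton]
  have hdiv : ∀ i, (p : B) ^ n ∣ g (s n i) - g (L i) := by
    intro i
    have := hL i n
    rw [SModEq.sub_mem, span_singleton_pow, smul_eq_mul, mul_top, mem_span_singleton] at this
    simpa using map_dvd g this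
  have : x - ∑ i, g (L i) * b i = ∑ i, (g (s n i) - g (L i)) * b i + p ^ n * r^[n] x := by
    conv_lhs => rw [hs n]
    simp only [sub_mul, Finset.sum_sub_distrib]
    ring
  rw [this]
  exact dvd_add (Finset.dvd_sum fun i _ => (hdiv i).mul_right _) (dvd_mul_right _ _)

open Ideal in
/-- A family in a `p`-torsion free algebra over a `p`-adically separated ring that is linearly
independent modulo `p` is linearly independent. -/
lemma eq_zero_of_sum_eq_zero_of_dvd {A B ι : Type*} [CommRing A] [CommRing B] [Fintype ι]
    (p : ℕ) [IsHausdorff (span {(p : A)}) A] (hB : ∀ y : B, p * y = 0 → y = 0)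
    (g : A →+* B) (b : ι → B)
    (hb : ∀ c : ι → A, (p : B) ∣ ∑ i, g (c i) * b i → ∀ i, (p : A) ∣ c i)
    (c : ι → A) (hc : ∑ i, g (c i) * b i = 0) : c = 0 := by
  have key : ∀ n, ∃ d : ι → A, ∑ i, g (d i) * b i = 0 ∧ ∀ i, c i = p ^ n * d i := by
    intro n
    induction n with
    | zero => exact ⟨c, hc, by simp⟩
    | succ n ih =>
      obtain ⟨d, hd, hcd⟩ := ih
      choose e he using hb d (hd ▸ dvd_zero _)
      refine ⟨e, hB _ ?_, fun i => by rw [hcd, he, pow_succ, mul_assoc]⟩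
      rw [← hd, Finset.mul_sum]
      simp only [he, map_mul, map_natCast, mul_assoc]
  funext i
  refine IsHausdorff.haus' (I := span {(p : A)}) _ fun n => ?_
  obtain ⟨d, -, hd⟩ := key n
  rw [SModEq.zero, span_singleton_pow, smul_eq_mul, mul_top, mem_span_singleton]
  exact ⟨_, hd i⟩

/-- The reduction of a `p`-adic integer modulo `p`, read off from its Witt vector. -/
def padicResidue (p : ℕ) [Fact p.Prime] (a : ℤ_[p]) : ZMod p :=
  ((WittVector.equiv p).symm a).coeff 0

lemma padicToWittFq_coeff_zero (p : ℕ) [Fact p.Prime] (f : ℕ) (a : ℤ_[p]) :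
    (padicToWittFq p f a).coeff 0 = algebraMap (ZMod p) (Fqf p f) (padicResidue p a) := by
  simp only [padicToWittFq, RingHom.comp_apply, RingEquiv.toRingHom_eq_coe, RingHom.coe_coe,
    WittVector.map_coeff]
  exact RingHom.congr_fun (Subsingleton.elim _ _) _

lemma padicResidue_surjective (p : ℕ) [Fact p.Prime] : Function.Surjective (padicResidue p) :=
  fun z => ⟨WittVector.equiv p (WittVector.teichmuller p z), by simp [padicResidue]⟩

lemma dvd_of_padicResidue_eq_zero {p : ℕ} [Fact p.Prime] {a : ℤ_[p]}
    (h : padicResidue p a = 0) : (p : ℤ_[p]) ∣ a := by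
  have := (WittVector.mem_span_p_iff_coeff_zero_eq_zero _).2 h
  rw [Ideal.mem_span_singleton] at this
  simpa using map_dvd (WittVector.equiv p) this

lemma wittVector_p_dvd_iff {p : ℕ} [Fact p.Prime] {f : ℕ} (hf : 0 < f)
    (x : WittVector p (Fqf p f)) : (p : WittVector p (Fqf p f)) ∣ x ↔ x.coeff 0 = 0 := by
  have := Fqf_finite p hf
  rw [← WittVector.mem_span_p_iff_coeff_zero_eq_zero, Ideal.mem_span_singleton]

lemma padicSum_coeff_zero {p : ℕ} [Fact p.Prime] {f : ℕ} (c : Fin f → ℤ_[p])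
    (x : WittVector p (Fqf p f)) :
    (∑ i : Fin f, padicToWittFq p f (c i) * (⇑(WittVector.frobenius :
      WittVector p (Fqf p f) →+* WittVector p (Fqf p f)))^[(i : ℕ)] x).coeff 0 =
    ∑ i : Fin f, algebraMap (ZMod p) (Fqf p f) (padicResidue p (c i)) * x.coeff 0 ^ p ^ (i : ℕ) := by
  rw [← WittVector.constantCoeff_apply, map_sum]
  refine Finset.sum_congr rfl fun i _ => ?_
  rw [map_mul, WittVector.constantCoeff_apply, WittVector.constantCoeff_apply,
    WittVector.iterate_frobenius_coeff, padicToWittFq_coeff_zero]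

lemma frobenius_iterate_eq_self {p : ℕ} [Fact p.Prime] {f : ℕ} (x : WittVector p (Fqf p f)) :
    (⇑(WittVector.frobenius : WittVector p (Fqf p f) →+* WittVector p (Fqf p f)))^[f] x = x := by
  ext n
  rw [WittVector.iterate_frobenius_coeff]
  exact mem_Fqf.1 (x.coeff n).2

lemma Fqf_coe_algebraMap (p : ℕ) [Fact p.Prime] (f : ℕ) (z : ZMod p) :
    ((algebraMap (ZMod p) (Fqf p f) z : Fqf p f) : AlgebraicClosure (ZMod p))
      = algebraMap (ZMod p) (AlgebraicClosure (ZMod p)) z :=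
  RingHom.congr_fun (Subsingleton.elim
    ((Fqf p f).subtype.comp (algebraMap (ZMod p) (Fqf p f)))
    (algebraMap (ZMod p) (AlgebraicClosure (ZMod p)))) z

lemma IsNormalGen.bijective {p : ℕ} [Fact p.Prime] {f : ℕ} (hf : 0 < f) (u : Fqf p f)
    (hu : IsNormalGen p f u) :
    Function.Bijective fun d : Fin f → ZMod p =>
      ∑ i, algebraMap (ZMod p) (Fqf p f) (d i) * u ^ p ^ (i : ℕ) := by
  have := Fqf_finite p hf
  refine Function.Surjective.bijective_of_nat_card_le (fun y => ?_) ?_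
  · have hy := hu.2 y y.2
    have hr : (Set.range fun i : ℕ => (u : AlgebraicClosure (ZMod p)) ^ p ^ i)
        = Set.range fun i : Fin f => (u : AlgebraicClosure (ZMod p)) ^ p ^ (i : ℕ) := by
      refine Set.Subset.antisymm ?_ ?_
      · rintro _ ⟨i, rfl⟩
        refine ⟨⟨i % f, Nat.mod_lt _ hf⟩, ?_⟩
        have hk : (u : AlgebraicClosure (ZMod p)) ^ p ^ (f * (i / f)) = u :=
          mem_Fqf.1 (Fqf_le p (Dvd.intro _ rfl) u.2)
        beta_reduce
        conv_rhs => rw [← Nat.div_add_mod i f, pow_add, pow_mul, hk]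
      · rintro _ ⟨i, rfl⟩
        exact ⟨i, rfl⟩
    rw [hr, Submodule.mem_span_range_iff_exists_fun] at hy
    obtain ⟨d, hd⟩ := hy
    refine ⟨d, Subtype.ext ?_⟩
    rw [← hd]
    simp [Algebra.smul_def, Fqf_coe_algebraMap]
  · simp [Fqf_card p hf]

lemma IsNormalGen.existsUnique {p : ℕ} [Fact p.Prime] {f : ℕ} (hf : 0 < f) (u : Fqf p f)
    (hu : IsNormalGen p f u) (x : WittVector p (Fqf p f)) :
    ∃! c : Fin f → ℤ_[p], x = ∑ i : Fin f, padicToWittFq p f (c i) *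
      (⇑(WittVector.frobenius : WittVector p (Fqf p f) →+* WittVector p (Fqf p f)))^[(i : ℕ)]
        (WittVector.teichmuller p u) := by
  have := Fqf_finite p hf
  have hbij := hu.bijective hf u
  have hcomplete : IsAdicComplete (Ideal.span {(p : ℤ_[p])}) ℤ_[p] := by
    rw [← PadicInt.maximalIdeal_eq_span_p]
    infer_instance
  refine existsUnique_of_exists_of_unique
    (exists_eq_sum_of_exists_eq_sum_add_mul p (padicToWittFq p f) _ (fun x => ?_) x) ?_
  · obtain ⟨d, hd⟩ := hbij.2 (x.coeff 0)
    choose c hc using fun i => padicResidue_surjective p (d i)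
    have : (p : WittVector p (Fqf p f)) ∣ x - ∑ i : Fin f, padicToWittFq p f (c i) *
        (⇑(WittVector.frobenius : WittVector p (Fqf p f) →+* WittVector p (Fqf p f)))^[(i : ℕ)]
          (WittVector.teichmuller p u) := by
      rw [wittVector_p_dvd_iff hf, ← WittVector.constantCoeff_apply, map_sub,
        WittVector.constantCoeff_apply, WittVector.constantCoeff_apply, padicSum_coeff_zero]
      simp only [hc, WittVector.teichmuller_coeff_zero, ← hd, sub_self]
    obtain ⟨y, hy⟩ := this
    exact ⟨c, y, by rw [← hy]; ring⟩
  · intro c d hc hd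
    rw [← sub_eq_zero]
    refine eq_zero_of_sum_eq_zero_of_dvd p
      (fun y hy => WittVector.eq_zero_of_p_mul_eq_zero y (by rwa [mul_comm])) (padicToWittFq p f)
      (fun i : Fin f => (⇑(WittVector.frobenius :
        WittVector p (Fqf p f) →+* WittVector p (Fqf p f)))^[(i : ℕ)]
          (WittVector.teichmuller p u)) (fun e he i => ?_) _ ?_
    · rw [wittVector_p_dvd_iff hf, padicSum_coeff_zero, WittVector.teichmuller_coeff_zero] at he
      have h0 : (fun i => padicResidue p (e i)) = 0 := hbij.1 (by simpa using he)
      exact dvd_of_padicResidue_eq_zero (congrFun h0 i)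
    · simp only [Pi.sub_apply, map_sub, sub_mul, Finset.sum_sub_distrib]
      rw [← hc, ← hd, sub_self]

lemma frobenius_iterate_wittTrace {p : ℕ} [Fact p.Prime] {f' f : ℕ} (h : f' ∣ f)
    (x : WittVector p (Fqf p f)) :
    (⇑(WittVector.frobenius : WittVector p (Fqf p f) →+* WittVector p (Fqf p f)))^[f']
      (wittTrace p f f' x) = wittTrace p f f' x := by
  have hlast : (⇑(WittVector.frobenius :
      WittVector p (Fqf p f) →+* WittVector p (Fqf p f)))^[f' * (f / f')] x = x := by
    rw [Nat.mul_div_cancel' h, frobenius_iterate_eq_self]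
  rw [wittTrace, ← RingHom.coe_pow, map_sum, RingHom.coe_pow]
  simp only [← Function.iterate_add_apply]
  have := (Finset.sum_range_succ' (fun j => (⇑(WittVector.frobenius :
      WittVector p (Fqf p f) →+* WittVector p (Fqf p f)))^[f' * j] x) (f / f')).symm.trans
    (Finset.sum_range_succ _ _)
  rw [hlast, mul_zero, Function.iterate_zero, id] at this
  simpa only [mul_add, mul_one, add_comm f'] using add_right_cancel this

lemma map_inclusion_padicToWittFq (p : ℕ) [Fact p.Prime] {f' f : ℕ} (h : f' ∣ f) (a : ℤ_[p]) :
    WittVector.map (Subfield.inclusion (Fqf_le p h)) (padicToWittFq p f' a)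
      = padicToWittFq p f a := by
  ext n
  simp only [padicToWittFq, RingHom.comp_apply, WittVector.map_coeff]
  exact congrArg Subtype.val (RingHom.congr_fun (Subsingleton.elim
    ((Subfield.inclusion (Fqf_le p h)).comp (ZMod.castHom (dvd_refl p) (Fqf p f')))
    (ZMod.castHom (dvd_refl p) (Fqf p f))) _)

lemma map_inclusion_frobenius_iterate (p : ℕ) [Fact p.Prime] {f' f : ℕ} (h : f' ∣ f) (n : ℕ)
    (x : WittVector p (Fqf p f')) :
    WittVector.map (Subfield.inclusion (Fqf_le p h)) ((⇑(WittVector.frobenius :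
        WittVector p (Fqf p f') →+* WittVector p (Fqf p f')))^[n] x)
      = (⇑(WittVector.frobenius : WittVector p (Fqf p f) →+* WittVector p (Fqf p f)))^[n]
        (WittVector.map (Subfield.inclusion (Fqf_le p h)) x) := by
  ext k
  rw [WittVector.map_coeff, WittVector.iterate_frobenius_coeff,
    WittVector.iterate_frobenius_coeff, WittVector.map_coeff, map_pow]

lemma subfield_coe_inclusion {K : Type*} [Field K] {S T : Subfield K} (h : S ≤ T) (x : S) :
    (Subfield.inclusion h x : K) = x := rfl

lemma exists_map_inclusion_eq {p : ℕ} [Fact p.Prime] {f' f : ℕ} (h : f' ∣ f)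
    (w : WittVector p (Fqf p f))
    (hw : (⇑(WittVector.frobenius :
      WittVector p (Fqf p f) →+* WittVector p (Fqf p f)))^[f'] w = w) :
    ∃ y, WittVector.map (Subfield.inclusion (Fqf_le p h)) y = w := by
  have hmem : ∀ n, (w.coeff n : AlgebraicClosure (ZMod p)) ∈ Fqf p f' := fun n => by
    have hn : w.coeff n ^ p ^ f' = w.coeff n := by
      rw [← WittVector.iterate_frobenius_coeff, hw]
    rw [mem_Fqf, ← SubmonoidClass.coe_pow, hn]
  refine ⟨WittVector.mk p fun n => ⟨(w.coeff n : AlgebraicClosure (ZMod p)), hmem n⟩, ?_⟩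
  ext n
  rw [WittVector.map_coeff, WittVector.coeff_mk, subfield_coe_inclusion]

lemma wittTrace_coeff_zero {p : ℕ} [Fact p.Prime] (f' f : ℕ) (x : WittVector p (Fqf p f)) :
    ((wittTrace p f f' x).coeff 0 : AlgebraicClosure (ZMod p))
      = frobTrace p f' f (x.coeff 0) := by
  rw [frobTrace_apply, wittTrace, ← WittVector.constantCoeff_apply, map_sum]
  simp [WittVector.iterate_frobenius_coeff]

lemma exists_eq_sum_of_frobenius_iterate_eq {p : ℕ} [Fact p.Prime] {f' f : ℕ} (hf' : 0 < f')
    (h : f' ∣ f) (w : WittVector p (Fqf p f)) (u' : Fqf p f') (hu' : IsNormalGen p f' u')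
    (hw : (⇑(WittVector.frobenius :
      WittVector p (Fqf p f) →+* WittVector p (Fqf p f)))^[f'] w = w)
    (hw0 : (w.coeff 0 : AlgebraicClosure (ZMod p)) = u') :
    ∃ a : Fin f' → ℤ_[p],
      (∀ i : Fin f', (i : ℕ) = 0 → ∃ b : ℤ_[p], a i = 1 + p * b) ∧
      (∀ i : Fin f', (i : ℕ) ≠ 0 → ∃ b : ℤ_[p], a i = p * b) ∧
      w = ∑ i : Fin f', padicToWittFq p f (a i) *
          (⇑(WittVector.frobenius :
              WittVector p (Fqf p f) →+* WittVector p (Fqf p f)))^[(i : ℕ)]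
            (WittVector.map (Subfield.inclusion (Fqf_le p h)) (WittVector.teichmuller p u')) := by
  obtain ⟨y, rfl⟩ := exists_map_inclusion_eq h w hw
  have hy0 : y.coeff 0 = u' := by
    rw [WittVector.map_coeff, subfield_coe_inclusion] at hw0
    exact Subtype.ext hw0
  obtain ⟨z, hz⟩ : (p : WittVector p (Fqf p f')) ∣ y - WittVector.teichmuller p u' := by
    rw [wittVector_p_dvd_iff hf', ← WittVector.constantCoeff_apply, map_sub,
      WittVector.constantCoeff_apply, WittVector.constantCoeff_apply, hy0,
      WittVector.teichmuller_coeff_zero, sub_self]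
  obtain ⟨d, hd, -⟩ := hu'.existsUnique hf' u' z
  let i₀ : Fin f' := ⟨0, hf'⟩
  refine ⟨fun i => (if i = i₀ then 1 else 0) + p * d i, fun i hi => ⟨d i, ?_⟩,
    fun i hi => ⟨d i, ?_⟩, ?_⟩
  · simp [i₀, Fin.ext_iff, hi]
  · simp [i₀, Fin.ext_iff, hi]
  · rw [← sub_add_cancel y (WittVector.teichmuller p u'), hz, hd, add_comm]
    have hsum : ∑ i : Fin f', padicToWittFq p f (if i = i₀ then 1 else 0) *
        (⇑(WittVector.frobenius : WittVector p (Fqf p f) →+* WittVector p (Fqf p f)))^[(i : ℕ)]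
          (WittVector.map (Subfield.inclusion (Fqf_le p h)) (WittVector.teichmuller p u'))
        = WittVector.map (Subfield.inclusion (Fqf_le p h)) (WittVector.teichmuller p u') := by
      rw [Finset.sum_eq_single i₀ (fun i _ hi => by rw [if_neg hi, map_zero, zero_mul])
        (fun hi => absurd (Finset.mem_univ _) hi), if_pos rfl, map_one, one_mul]
      rfl
    simp only [map_add, map_mul, map_sum, map_natCast, map_inclusion_padicToWittFq p h,
      map_inclusion_frobenius_iterate p h, add_mul, Finset.sum_add_distrib, Finset.mul_sum,
      mul_assoc]
    rw [hsum]

/-- There is a family `(ζ_f)_{f ≥ 1}` of Teichmüller representatives `ζ_f ∈ W(𝔽_{p^f})`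
such that (i) the Frobenius orbit `(ζ_f, φ(ζ_f), …, φ^{f-1}(ζ_f))` is a `ℤ_p`-basis of
`W(𝔽_{p^f})` (every element is uniquely a `ℤ_p`-linear combination of it), and
(ii) for all `f' ∣ f` there are `a_0, …, a_{f'-1} ∈ ℤ_p` with `a_0 ≡ 1 (mod p)` and
`a_i ≡ 0 (mod p)` for `i ≠ 0`, such that
`Tr_{f/f'}(ζ_f) = ∑ i, a_i · φ^i(ι(ζ_{f'}))`, where `ι : W(𝔽_{p^{f'}}) → W(𝔽_{p^f})`
is the functorial injection. -/
theorem exists_compatible_teichmuller_normal_basis (p : ℕ) [Fact p.Prime] :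
    ∃ ζ : (f : ℕ) → WittVector p (Fqf p f),
      (∀ f : ℕ, 0 < f → ∃ u : Fqf p f, ζ f = WittVector.teichmuller p u) ∧
      (∀ f : ℕ, 0 < f → ∀ x : WittVector p (Fqf p f),
        ∃! c : Fin f → ℤ_[p],
          x = ∑ i : Fin f, padicToWittFq p f (c i) *
            (⇑(WittVector.frobenius :
                WittVector p (Fqf p f) →+* WittVector p (Fqf p f)))^[(i : ℕ)] (ζ f)) ∧
      (∀ f' f : ℕ, 0 < f' → 0 < f → ∀ h : f' ∣ f,
        ∃ a : Fin f' → ℤ_[p],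
          (∀ i : Fin f', (i : ℕ) = 0 → ∃ b : ℤ_[p], a i = 1 + p * b) ∧
          (∀ i : Fin f', (i : ℕ) ≠ 0 → ∃ b : ℤ_[p], a i = p * b) ∧
          wittTrace p f f' (ζ f) =
            ∑ i : Fin f', padicToWittFq p f (a i) *
              (⇑(WittVector.frobenius :
                  WittVector p (Fqf p f) →+* WittVector p (Fqf p f)))^[(i : ℕ)]
                (WittVector.map (Subfield.inclusion (Fqf_le p h)) (ζ f'))) := by
  obtain ⟨u, hu, htr⟩ := exists_compatible_isNormalGen p
  have hex : ∀ f, ∃ v : Fqf p f, 0 < f → (v : AlgebraicClosure (ZMod p)) = u f := fun f =>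
    if hf : 0 < f then ⟨⟨u f, (hu f hf).1⟩, fun _ => rfl⟩ else ⟨0, fun h => absurd h hf⟩
  choose v hv using hex
  have hv' : ∀ f, 0 < f → IsNormalGen p f (v f) := fun f hf => by
    rw [hv f hf]
    exact hu f hf
  refine ⟨fun f => WittVector.teichmuller p (v f), fun f _ => ⟨v f, rfl⟩,
    fun f hf => (hv' f hf).existsUnique hf _, fun f' f hf' hf h =>
      exists_eq_sum_of_frobenius_iterate_eq hf' h _ _ (hv' f' hf')
        (frobenius_iterate_wittTrace h _) ?_⟩
  rw [wittTrace_coeff_zero, WittVector.teichmuller_coeff_zero, hv f hf, hv f' hf', htr f' f hf' hf h]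
end
end

section
/- Let M be a finitely generated 𝓡-module with pd_𝓡(M) ≤ 1, and put N = E¹(M) = Ext¹_𝓡(M, 𝓡). Then M is torsion-free if and only if N is pseudo-null. -/
noncomputable section

/-- The duality hypothesis: `Hom_Λ(𝓡, Λ) ≅ 𝓡` as `𝓡`-modules, where the `𝓡`-module
structure on `Hom_Λ(𝓡, Λ)` is `(r • φ)(x) = φ (r * x)`. -/
def SelfDualAlgebra (Λ 𝓡 : Type) [CommRing Λ] [CommRing 𝓡] [Algebra Λ 𝓡] : Prop :=
  ∃ e : (𝓡 →ₗ[Λ] Λ) ≃ₗ[Λ] 𝓡,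
    ∀ (r : 𝓡) (φ : 𝓡 →ₗ[Λ] Λ),
      e (φ.comp (LinearMap.mulLeft Λ r)) = r * e φ

/-- `Λ` is a regular local ring: its maximal ideal is generated by `dim Λ` elements. -/
def IsRegularLocal (Λ : Type) [CommRing Λ] [IsLocalRing Λ] : Prop :=
  ∃ s : Finset Λ, Ideal.span (s : Set Λ) = IsLocalRing.maximalIdeal Λ ∧
    (s.card : WithBot (WithTop ℕ)) = ringKrullDim Λ

/-- A prime ideal `q` has height at most one: there is no chain of primes
`q₀ < q₁ < q`. -/
def HeightLEOne (Λ : Type) [CommRing Λ] (q : Ideal Λ) : Prop :=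
  ¬ ∃ q₀ q₁ : Ideal Λ, q₀.IsPrime ∧ q₁.IsPrime ∧ q₀ < q₁ ∧ q₁ < q

/-- An `𝓡`-module `N` is pseudo-null over `Λ`: for every prime `q` of `Λ` of height at
most one, the localization `N_q` vanishes, i.e. every element of `N` is annihilated by
some `s ∉ q`. -/
def IsPseudoNull (Λ : Type) [CommRing Λ] {𝓡 : Type} [CommRing 𝓡] [Algebra Λ 𝓡]
    (N : Type) [AddCommGroup N] [Module 𝓡 N] : Prop :=
  ∀ q : Ideal Λ, q.IsPrime → HeightLEOne Λ q →
    ∀ x : N, ∃ s : Λ, s ∉ q ∧ algebraMap Λ 𝓡 s • x = 0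

/-- A finitely generated module has projective dimension at most one: some (equivalently,
any) surjection from a finite free module has projective kernel. -/
def ProjDimLEOne (𝓡 : Type) [CommRing 𝓡] (M : Type) [AddCommGroup M] [Module 𝓡 M] :
    Prop :=
  ∃ (n : ℕ) (φ : (Fin n → 𝓡) →ₗ[𝓡] M),
    Function.Surjective φ ∧ Module.Projective 𝓡 (LinearMap.ker φ)

abbrev ExtGrp (R : Type) [CommRing R] (M : Type) [AddCommGroup M] [Module R M] (i : ℕ) :
    ModuleCat R :=
  ((_root_.Ext R (ModuleCat R) i).obj (Opposite.op (ModuleCat.of R M))).obj (ModuleCat.of R R)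

theorem exists_prime_colon_of_not_dvd {A : Type*} [CommRing A] [IsNoetherianRing A] {a b : A}
    (h : ¬ a ∣ b) :
    ∃ q : Ideal A, q.IsPrime ∧ (∃ c, ∀ r, r ∈ q ↔ a ∣ r * c) ∧ ∀ r, a ∣ r * b → r ∈ q := by
  have hb : Ideal.Quotient.mk (Ideal.span {a}) b ≠ 0 := by
    rwa [Ne, Ideal.Quotient.eq_zero_iff_mem, Ideal.mem_span_singleton]
  have key : ∀ r c : A, r ∈ (⊥ : Submodule A (A ⧸ Ideal.span {a})).colon
      {Ideal.Quotient.mk (Ideal.span {a}) c} ↔ a ∣ r * c := by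
    intro r c
    rw [Submodule.mem_colon_singleton, Submodule.mem_bot, Algebra.smul_def,
      Ideal.Quotient.algebraMap_eq, ← map_mul, Ideal.Quotient.eq_zero_iff_mem,
      Ideal.mem_span_singleton]
  obtain ⟨P, hP, hle⟩ := exists_le_isAssociatedPrime_of_isNoetherianRing A _ hb
  rw [isAssociatedPrime_iff] at hP
  obtain ⟨hprime, y, hy⟩ := hP
  obtain ⟨c, rfl⟩ := Ideal.Quotient.mk_surjective y
  refine ⟨P, hprime, ⟨c, fun r ↦ ?_⟩, fun r hr ↦ hle ((key r b).2 hr)⟩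
  rw [hy, key]

/-- If `x` is a nonzerodivisor modulo `a` in the maximal ideal, then a proper colon ideal
`(a : b)` can be written as `(a : b')` with `b'` nonzero modulo `(a, x)`. -/
theorem exists_colon_eq_of_regular_mod {A : Type*} [CommRing A] [IsNoetherianRing A]
    [IsLocalRing A] {a b x : A} (hx : x ∈ IsLocalRing.maximalIdeal A)
    (hreg : ∀ c, a ∣ x * c → a ∣ c) (hb : ¬ a ∣ b) :
    ∃ b', (∀ r, a ∣ r * b' ↔ a ∣ r * b) ∧ b' ∉ Ideal.span {a, x} := by
  obtain ⟨J, ⟨b', rfl, hb'⟩, hmax⟩ := set_has_maximal_iff_noetherian.mpr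
    (inferInstanceAs (IsNoetherian A A))
    {J : Ideal A | ∃ b', J = Ideal.span {a, b'} ∧ ∀ r, a ∣ r * b' ↔ a ∣ r * b}
    ⟨_, b, rfl, fun _ ↦ Iff.rfl⟩
  refine ⟨b', hb', fun hmem ↦ ?_⟩
  obtain ⟨u, b'', h⟩ := Ideal.mem_span_pair.1 hmem
  have hcolon : ∀ r, a ∣ r * b'' ↔ a ∣ r * b := by
    intro r
    rw [← hb' r]
    have e : r * b' = a * (u * r) + x * (r * b'') := by rw [← h]; ring
    rw [e, dvd_add_right (dvd_mul_right _ _)]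
    exact ⟨fun hd ↦ hd.mul_left _, hreg _⟩
  have hle : Ideal.span {a, b'} ≤ Ideal.span {a, b''} := by
    rw [Ideal.span_le]
    rintro y (rfl | rfl)
    · exact Ideal.subset_span (by simp)
    · exact Ideal.mem_span_pair.2 ⟨u, x, by rw [← h]; ring⟩
  have heq : Ideal.span {a, b'} = Ideal.span {a, b''} :=
    hle.eq_of_not_lt (hmax _ ⟨b'', rfl, hcolon⟩)
  have hmem' : b'' ∈ Ideal.span {a, b'} := heq ▸ Ideal.subset_span (by simp)
  obtain ⟨v, w, hvw⟩ := Ideal.mem_span_pair.1 hmem'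
  have hunit : IsUnit (1 - w * x) := by
    by_contra hn
    have h1 : (1 - w * x) ∈ IsLocalRing.maximalIdeal A := hn
    have h2 := Ideal.add_mem _ h1 (Ideal.mul_mem_left _ w hx)
    rw [sub_add_cancel] at h2
    exact (Ideal.ne_top_iff_one _).1 (IsLocalRing.maximalIdeal.isMaximal A).ne_top h2
  have h3 : a ∣ (1 - w * x) * b'' := ⟨v + w * u, by linear_combination -hvw - w * h⟩
  rw [hunit.dvd_mul_left] at h3
  exact hb (by simpa using (hcolon 1).1 (by simpa using h3))

/-- Associated primes of `A ⧸ (a)` have height at most one, for `a ≠ 0`. -/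
def ColonPrimesHeightLEOne (A : Type*) [CommRing A] : Prop :=
  ∀ a b : A, a ≠ 0 → ∀ q : Ideal A, q.IsPrime → (∀ r, r ∈ q ↔ a ∣ r * b) → q.height ≤ 1

theorem ColonPrimesHeightLEOne.of_quotient_prime {A : Type*} [CommRing A] [IsDomain A]
    [IsNoetherianRing A] [IsLocalRing A] {x : A} (hx : Prime x)
    (h : ColonPrimesHeightLEOne (A ⧸ Ideal.span {x})) : ColonPrimesHeightLEOne A := by
  have coprime : ∀ a b : A, ¬ x ∣ a → ∀ q : Ideal A, q.IsPrime →
      (∀ r, r ∈ q ↔ a ∣ r * b) → q.height ≤ 1 := by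
    intro a b hxa q hq hqb
    have hreg : ∀ c, a ∣ x * c → a ∣ c := by
      rintro c ⟨d, hd⟩
      rcases hx.dvd_or_dvd (Dvd.intro _ hd : x ∣ a * d) with h' | ⟨d', rfl⟩
      · exact absurd h' hxa
      · exact ⟨d', mul_left_cancel₀ hx.ne_zero (by rw [hd]; ring)⟩
    have hab : ¬ a ∣ b := fun hd ↦ hq.ne_top ((Ideal.eq_top_iff_one _).2 ((hqb 1).2 (by simpa)))
    obtain ⟨b', hb', hmem⟩ := exists_colon_eq_of_regular_mod
      ((IsLocalRing.mem_maximalIdeal x).2 hx.not_isUnit) hreg hab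
    set f := Ideal.Quotient.mk (Ideal.span {x})
    have hf : Function.Surjective f := Ideal.Quotient.mk_surjective
    have hfz : ∀ y, f y = 0 ↔ x ∣ y := fun y ↦ by
      rw [Ideal.Quotient.eq_zero_iff_mem, Ideal.mem_span_singleton]
    have hnd : ¬ f a ∣ f b' := by
      rintro ⟨c, hc⟩
      obtain ⟨c, rfl⟩ := hf c
      rw [← map_mul, ← sub_eq_zero, ← map_sub, hfz] at hc
      obtain ⟨d, hd⟩ := hc
      exact hmem (Ideal.mem_span_pair.2 ⟨c, d, by linear_combination -hd⟩)
    obtain ⟨Q, hQ, ⟨c, hc⟩, hQb⟩ := exists_prime_colon_of_not_dvd hnd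
    have hfa : f a ≠ 0 := by rwa [Ne, hfz]
    have hQ1 := h (f a) c hfa Q hQ hc
    have hxQ : x ∈ Q.comap f := by
      rw [Ideal.mem_comap, (hfz x).2 dvd_rfl]
      exact Q.zero_mem
    have h2 : (Q.comap f).height ≤ 1 + 1 := by
      refine (Ideal.height_le_height_add_one_of_mem hxQ).trans ?_
      rw [Ideal.map_comap_of_surjective _ hf]
      gcongr
    have hlt : q < Q.comap f := by
      refine lt_of_le_of_ne (fun r hr ↦ ?_) ?_
      · apply hQb
        rw [← map_mul]
        exact map_dvd f ((hb' r).2 ((hqb r).1 hr))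
      · rintro rfl
        exact hab (hreg _ ((hqb x).1 hxQ))
    have hfin : q.height ≠ ⊤ := Ideal.height_ne_top hq.ne_top
    have h3 : q.height + 1 ≤ (Q.comap f).height := by
      have := hQ.comap f
      exact Ideal.height_add_one_le_of_lt_of_isPrime hlt
    have h4 := h3.trans h2
    exact (ENat.add_le_add_iff_right (by simp)).1 h4
  intro a b ha q hq hqb
  obtain ⟨n, a', ha', rfl⟩ := WfDvdMonoid.max_power_factor ha hx.irreducible
  induction n generalizing b with
  | zero => exact coprime _ b (by simpa using ha') q hq hqb
  | succ n ih =>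
    by_cases hr : ∃ r, r ∉ q ∧ x ∣ r * b
    · obtain ⟨r, hrq, c, hc⟩ := hr
      refine ih c (fun h0 ↦ ha (by rw [pow_succ', mul_assoc, h0, mul_zero])) fun t ↦ ?_
      have : t ∈ q ↔ t * r ∈ q := ⟨fun ht ↦ q.mul_mem_right _ ht,
        fun ht ↦ (hq.mem_or_mem ht).resolve_right hrq⟩
      rw [this, hqb, mul_assoc, hc, mul_left_comm t, pow_succ', mul_assoc x,
        mul_dvd_mul_iff_left hx.ne_zero]
    · push Not at hr
      have hxb : ¬ x ∣ b := fun hd ↦ hr 1 ((Ideal.ne_top_iff_one _).1 hq.ne_top) (by simpa)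
      have : q = Ideal.span {x} := by
        ext t
        rw [Ideal.mem_span_singleton]
        constructor
        · intro ht
          have h1 := (hqb t).1 ht
          rw [pow_succ', mul_assoc] at h1
          exact (hx.dvd_or_dvd ((dvd_mul_right _ _).trans h1)).resolve_right hxb
        · intro ht
          by_contra hn
          exact hr t hn (ht.mul_right _)
      rw [this]
      exact Ideal.height_span_singleton_le_one hx.not_isUnit

/-- A Noetherian local ring is a domain if some prime is contained in a principal ideal whose
generator lies outside it. -/
theorem isDomain_of_prime_le_span_singleton {A : Type*} [CommRing A] [IsNoetherianRing A]
    [IsLocalRing A] {x : A} (hx : x ∈ IsLocalRing.maximalIdeal A) {p : Ideal A} (hp : p.IsPrime)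
    (hle : p ≤ Ideal.span {x}) (hxp : x ∉ p) : IsDomain A := by
  have : p = ⊥ := by
    refine Submodule.eq_bot_of_le_smul_of_le_jacobson_bot (Ideal.span {x}) p
      (IsNoetherian.noetherian p) ?_ ?_
    · intro y hy
      obtain ⟨c, rfl⟩ := Ideal.mem_span_singleton'.1 (hle hy)
      rw [mul_comm]
      exact Submodule.smul_mem_smul (Ideal.mem_span_singleton_self x)
        ((hp.mem_or_mem hy).resolve_right hxp)
    · rw [IsLocalRing.jacobson_eq_maximalIdeal _ bot_ne_top]
      simpa using hx
  exact (IsDomain.of_bot_isPrime (hbp := this ▸ hp))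

theorem ringKrullDim_le_card_of_span_eq_maximalIdeal {A : Type*} [CommRing A] [IsNoetherianRing A]
    [IsLocalRing A] {s : Finset A} (hs : Ideal.span (s : Set A) = IsLocalRing.maximalIdeal A) :
    ringKrullDim A ≤ s.card := by
  refine (ringKrullDim_le_spanFinrank_maximalIdeal A).trans ?_
  rw [← hs]
  have := Submodule.spanFinrank_span_le_encard (R := A) (s : Set A)
  rw [Set.encard_coe_eq_coe_finsetCard] at this
  exact_mod_cast this

theorem exists_prime_le_ringKrullDim_quotient {A : Type*} [CommRing A] {n : ℕ}
    (h : (n : WithBot ℕ∞) ≤ ringKrullDim A) :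
    ∃ p : Ideal A, p.IsPrime ∧ (n : WithBot ℕ∞) ≤ ringKrullDim (A ⧸ p) := by
  obtain ⟨l, hl⟩ := Order.le_krullDim_iff.1 h
  refine ⟨l.head.asIdeal, l.head.isPrime, ?_⟩
  rw [ringKrullDim_quotient, Order.le_krullDim_iff]
  refine ⟨⟨l.length, fun i ↦ ⟨l i, ?_⟩, fun i ↦ l.step i⟩, hl⟩
  exact l.head_le i

theorem isDomain_and_colonPrimes_of_span_eq_maximalIdeal (n : ℕ) :
    ∀ (A : Type) [CommRing A] [IsNoetherianRing A] [IsLocalRing A] (s : Finset A),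
      Ideal.span (s : Set A) = IsLocalRing.maximalIdeal A → s.card ≤ n →
      (n : WithBot ℕ∞) ≤ ringKrullDim A → IsDomain A ∧ ColonPrimesHeightLEOne A := by
  induction n with
  | zero =>
    intro A _ _ _ s hs hcard _
    have hs0 : s = ∅ := Finset.card_eq_zero.1 (Nat.le_zero.1 hcard)
    have hm : IsLocalRing.maximalIdeal A = ⊥ := by rw [← hs, hs0]; simp
    have hf := IsLocalRing.isField_iff_maximalIdeal_eq.2 hm
    refine ⟨hf.isDomain, fun a b ha q hq _ ↦ ?_⟩
    let := hf.toField
    have hq0 : q = ⊥ := Ideal.eq_bot_of_prime q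
    rw [hq0]
    simp
  | succ n ih =>
    intro A _ _ _ s hs hcard hdim
    have hdim' := hdim.trans (ringKrullDim_le_card_of_span_eq_maximalIdeal hs)
    have hcard' : n + 1 ≤ s.card := by exact_mod_cast hdim'
    obtain ⟨x, hxs⟩ := Finset.card_pos.1 (show 0 < s.card by omega)
    have hxm : x ∈ IsLocalRing.maximalIdeal A := hs ▸ Ideal.subset_span hxs
    set f := Ideal.Quotient.mk (Ideal.span {x})
    have hf : Function.Surjective f := Ideal.Quotient.mk_surjective
    have hfz : ∀ y, f y = 0 ↔ y ∈ Ideal.span {x} := fun y ↦ Ideal.Quotient.eq_zero_iff_mem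
    have hne : Ideal.span {x} ≠ ⊤ := by
      rw [Ne, Ideal.span_singleton_eq_top]
      exact hxm
    have : Nontrivial (A ⧸ Ideal.span {x}) := Ideal.Quotient.nontrivial_iff.2 hne
    have : IsLocalRing (A ⧸ Ideal.span {x}) := .of_surjective' f hf
    classical
    have hspan : Ideal.span (((s.erase x).image f : Finset _) : Set (A ⧸ Ideal.span {x})) =
        IsLocalRing.maximalIdeal _ := by
      rw [← IsLocalRing.map_maximalIdeal_of_surjective f hf, ← hs, Ideal.map_span]
      refine le_antisymm (Ideal.span_mono ?_) (Ideal.span_le.2 ?_)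
      · rw [Finset.coe_image]
        exact Set.image_mono (by simp)
      · rintro _ ⟨y, hy, rfl⟩
        by_cases hyx : y = x
        · subst hyx
          rw [(hfz y).2 (Ideal.mem_span_singleton_self y)]
          exact zero_mem _
        · refine Ideal.subset_span ?_
          rw [Finset.coe_image]
          exact ⟨y, by simpa [hyx] using hy, rfl⟩
    have hc : ((s.erase x).image f).card ≤ n := by
      refine Finset.card_image_le.trans ?_
      rw [Finset.card_erase_of_mem hxs]
      omega
    have hdimA : (n : WithBot ℕ∞) ≤ ringKrullDim (A ⧸ Ideal.span {x}) := by
      have h1 := ringKrullDim_le_ringKrullDim_quotient_add_card ({x} : Finset A)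
        (by rw [IsLocalRing.ringJacobson_eq_maximalIdeal]; simpa using hxm)
      rw [Finset.coe_singleton, Finset.card_singleton] at h1
      have h2 := hdim.trans h1
      push_cast at h2
      exact ENat.WithBot.add_le_add_one_right_iff.1 h2
    obtain ⟨hdom, hcol⟩ := ih _ _ hspan hc hdimA
    have hxprime : (Ideal.span {x}).IsPrime := (Ideal.Quotient.isDomain_iff_prime _).1 hdom
    have hdimA' : ringKrullDim (A ⧸ Ideal.span {x}) ≤ n :=
      (ringKrullDim_le_card_of_span_eq_maximalIdeal hspan).trans (by exact_mod_cast hc)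
    obtain ⟨p, hp, hpdim⟩ := exists_prime_le_ringKrullDim_quotient hdim
    have hlt : ¬ ((n + 1 : ℕ) : WithBot ℕ∞) ≤ n := by
      intro h
      have : n + 1 ≤ n := by exact_mod_cast h
      omega
    have hxp : x ∉ p := by
      intro hmem
      have h1 : ringKrullDim (A ⧸ p) ≤ ringKrullDim (A ⧸ Ideal.span {x}) :=
        ringKrullDim_le_of_surjective
          (Ideal.Quotient.factor ((Ideal.span_singleton_le_iff_mem p).2 hmem))
          (Ideal.Quotient.factor_surjective _)
      exact hlt (hpdim.trans (h1.trans hdimA'))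
    have hple : p ≤ Ideal.span {x} := by
      intro c hcp
      by_contra hcx
      have : Nontrivial (A ⧸ p) := Ideal.Quotient.nontrivial_iff.2 hp.ne_top
      have : IsLocalRing (A ⧸ p) := .of_surjective' _ Ideal.Quotient.mk_surjective
      have h1 := ringKrullDim_le_ringKrullDim_quotient_add_card
        ({Ideal.Quotient.mk p x} : Finset (A ⧸ p)) (by
          rw [IsLocalRing.ringJacobson_eq_maximalIdeal,
            ← IsLocalRing.map_maximalIdeal_of_surjective _ (Ideal.Quotient.mk_surjective (I := p))]
          rw [Finset.coe_singleton, Set.singleton_subset_iff]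
          exact Ideal.mem_map_of_mem _ hxm)
      rw [Finset.coe_singleton, Finset.card_singleton] at h1
      have h2 := ringKrullDim_quotient_succ_le_of_nonZeroDivisor (r := f c)
        (mem_nonZeroDivisors_of_ne_zero (by rwa [Ne, hfz]))
      let g : (A ⧸ Ideal.span {x}) →+* (A ⧸ p) ⧸ Ideal.span {Ideal.Quotient.mk p x} :=
        Ideal.Quotient.lift _ ((Ideal.Quotient.mk _).comp (Ideal.Quotient.mk p)) (by
          intro y hy
          obtain ⟨z, rfl⟩ := Ideal.mem_span_singleton'.1 hy
          simp only [RingHom.comp_apply, map_mul, Ideal.Quotient.mk_singleton_self, mul_zero])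
      let g' : (A ⧸ Ideal.span {x}) ⧸ Ideal.span {f c} →+*
          (A ⧸ p) ⧸ Ideal.span {Ideal.Quotient.mk p x} :=
        Ideal.Quotient.lift _ g (by
          intro y hy
          obtain ⟨z, rfl⟩ := Ideal.mem_span_singleton'.1 hy
          have : g (f c) = 0 := by
            change Ideal.Quotient.mk _ (Ideal.Quotient.mk p c) = 0
            rw [Ideal.Quotient.eq_zero_iff_mem.2 hcp, map_zero]
          rw [map_mul, this, mul_zero])
      have hg' : Function.Surjective g' := by
        intro y
        obtain ⟨y, rfl⟩ := Ideal.Quotient.mk_surjective y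
        obtain ⟨y, rfl⟩ := Ideal.Quotient.mk_surjective y
        exact ⟨Ideal.Quotient.mk _ (f y), rfl⟩
      have h3 := ringKrullDim_le_of_surjective g' hg'
      refine hlt (hpdim.trans (h1.trans (le_trans ?_ (h2.trans hdimA'))))
      gcongr
      simp
    have := isDomain_of_prime_le_span_singleton hxm hp hple hxp
    have hx0 : x ≠ 0 := fun h ↦ hxp (h ▸ p.zero_mem)
    exact ⟨this, .of_quotient_prime ((Ideal.span_singleton_prime hx0).1 hxprime) hcol⟩

theorem heightLEOne_of_height_le_one {Λ : Type} [CommRing Λ] {q : Ideal Λ} [q.IsPrime]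
    (h : q.height ≤ 1) : HeightLEOne Λ q := by
  rintro ⟨q₀, q₁, h₀, h₁, h₀₁, h₁q⟩
  have e₁ := Ideal.height_add_one_le_of_lt_of_isPrime h₀₁
  have e₂ := Ideal.height_add_one_le_of_lt_of_isPrime h₁q
  have h3 : (1 : ℕ∞) + 1 ≤ 1 := calc
    (1 : ℕ∞) + 1 ≤ (q₀.height + 1) + 1 := by gcongr; exact le_add_self
    _ ≤ q₁.height + 1 := by gcongr
    _ ≤ q.height := e₂
    _ ≤ 1 := h
  exact absurd h3 (by decide)

/-- Every linear form on the kernel of `φ` extends to the source of `φ` after multiplication by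
an element of `T`. -/
def ExtendsUpTo {R F M : Type*} [CommRing R] [AddCommGroup F] [Module R F] [AddCommGroup M]
    [Module R M] (T : Set R) (φ : F →ₗ[R] M) : Prop :=
  ∀ f : LinearMap.ker φ →ₗ[R] R, ∃ s ∈ T, ∃ g : F →ₗ[R] R, ∀ k : LinearMap.ker φ, g k = s * f k

theorem ExtendsUpTo.of_surjective {R F Q M : Type*} [CommRing R] [AddCommGroup F] [Module R F]
    [AddCommGroup Q] [Module R Q] [AddCommGroup M] [Module R M] [Module.Projective R F]
    [Module.Projective R Q] {T : Set R} {φ : F →ₗ[R] M} {ψ : Q →ₗ[R] M}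
    (hφ : Function.Surjective φ) (hψ : Function.Surjective ψ) (h : ExtendsUpTo T φ) :
    ExtendsUpTo T ψ := by
  obtain ⟨α, hα⟩ := Module.projective_lifting_property φ ψ hφ
  obtain ⟨β, hβ⟩ := Module.projective_lifting_property ψ φ hψ
  have hα' : ∀ x, φ (α x) = ψ x := fun x ↦ LinearMap.congr_fun hα x
  have hβ' : ∀ x, ψ (β x) = φ x := fun x ↦ LinearMap.congr_fun hβ x
  intro f
  have hres : ∀ k ∈ LinearMap.ker φ, β k ∈ LinearMap.ker ψ := fun k hk ↦ by
    rw [LinearMap.mem_ker, hβ']; exact hk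
  obtain ⟨s, hs, G, hG⟩ := h (f ∘ₗ β.restrict hres)
  let δ : Q →ₗ[R] LinearMap.ker ψ := (LinearMap.id - β ∘ₗ α).codRestrict _ fun x ↦ by
    simp [hβ', hα']
  refine ⟨s, hs, G ∘ₗ α + s • (f ∘ₗ δ), fun k ↦ ?_⟩
  have hk : α k ∈ LinearMap.ker φ := by
    rw [LinearMap.mem_ker, hα']; exact k.2
  have h1 := hG ⟨α k, hk⟩
  have h2 : β.restrict hres ⟨α k, hk⟩ + δ k = k := by
    ext; simp [δ]
  have h3 : f (β.restrict hres ⟨α k, hk⟩) + f (δ k) = f k := by rw [← map_add, h2]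
  simp only [LinearMap.add_apply, LinearMap.smul_apply, LinearMap.comp_apply, smul_eq_mul] at h1 ⊢
  rw [h1, ← h3, mul_add]

/-- For a finite projective kernel, finitely many linear forms suffice to extend, up to scaling,
the identity of the kernel. -/
theorem ExtendsUpTo.exists_retraction {R F M : Type*} [CommRing R] [AddCommGroup F] [Module R F]
    [AddCommGroup M] [Module R M] {S : Submonoid R} {φ : F →ₗ[R] M}
    [Module.Projective R (LinearMap.ker φ)] [Module.Finite R (LinearMap.ker φ)]
    (h : ExtendsUpTo S φ) :
    ∃ s ∈ S, ∃ B : F →ₗ[R] LinearMap.ker φ, ∀ k : LinearMap.ker φ, B k = s • k := by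
  classical
  obtain ⟨n, p, i, -, -, hpi⟩ := Module.Finite.exists_comp_eq_id_of_projective R (LinearMap.ker φ)
  choose s hs g hg using fun j : Fin n ↦ h (LinearMap.proj j ∘ₗ i)
  refine ⟨∏ j, s j, prod_mem fun j _ ↦ hs j,
    p ∘ₗ LinearMap.pi fun j ↦ (∏ l ∈ Finset.univ.erase j, s l) • g j, fun k ↦ ?_⟩
  have h1 : (LinearMap.pi fun j ↦ (∏ l ∈ Finset.univ.erase j, s l) • g j) (k : F) =
      (∏ j, s j) • i k := by
    ext j
    simp only [LinearMap.pi_apply, LinearMap.smul_apply, hg, LinearMap.comp_apply,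
      LinearMap.proj_apply, smul_eq_mul, Pi.smul_apply]
    rw [← mul_assoc, Finset.prod_erase_mul _ _ (Finset.mem_univ j)]
  rw [LinearMap.comp_apply, h1, map_smul]
  congr 1
  exact LinearMap.congr_fun hpi k

open CategoryTheory in
theorem moduleCat_forall_exists_smul_eq_zero_congr {R : Type*} [CommRing R] {A B : ModuleCat R}
    (e : A ≅ B) (T : Set R) :
    (∀ x : A, ∃ s ∈ T, s • x = 0) ↔ ∀ x : B, ∃ s ∈ T, s • x = 0 := by
  have e' := e.toLinearEquiv
  refine ⟨fun h x ↦ ?_, fun h x ↦ ?_⟩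
  · obtain ⟨s, hs, h0⟩ := h (e'.symm x)
    exact ⟨s, hs, e'.symm.injective (by rw [map_smul, h0, map_zero])⟩
  · obtain ⟨s, hs, h0⟩ := h (e' x)
    exact ⟨s, hs, e'.injective (by rw [map_smul, h0, map_zero])⟩

open CategoryTheory in
theorem moduleCat_homology_forall_exists_smul_eq_zero_iff {R : Type*} [CommRing R]
    (S : ShortComplex (ModuleCat R)) (T : Set R) :
    (∀ x : S.homology, ∃ s ∈ T, s • x = 0) ↔
      ∀ z : S.X₂, S.g z = 0 → ∃ s ∈ T, ∃ y : S.X₁, S.f y = s • z := by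
  rw [moduleCat_forall_exists_smul_eq_zero_congr S.moduleCatHomologyIso]
  change (∀ x : LinearMap.ker S.g.hom ⧸ LinearMap.range S.moduleCatToCycles, _) ↔ _
  have key : ∀ (s : R) (z : LinearMap.ker S.g.hom),
      s • (LinearMap.range S.moduleCatToCycles).mkQ z = 0 ↔ ∃ y : S.X₁, S.f y = s • (z : S.X₂) := by
    intro s z
    rw [← map_smul, Submodule.mkQ_apply, Submodule.Quotient.mk_eq_zero, LinearMap.mem_range]
    simp only [Subtype.ext_iff]
    rfl
  refine ⟨fun h z hz ↦ ?_, fun h x ↦ ?_⟩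
  · obtain ⟨s, hs, h0⟩ := h ((LinearMap.range S.moduleCatToCycles).mkQ ⟨z, hz⟩)
    exact ⟨s, hs, (key s ⟨z, hz⟩).1 h0⟩
  · obtain ⟨z, rfl⟩ := Submodule.mkQ_surjective _ x
    obtain ⟨s, hs, y, hy⟩ := h z z.2
    exact ⟨s, hs, (key s z).2 ⟨y, hy⟩⟩

open CategoryTheory in
/-- `Ext¹(M, R)` is killed elementwise by `T` if and only if the linear forms on the first syzygy
extend up to elements of `T`. -/
theorem exists_extendsUpTo_iff_ext_one {R : Type} [CommRing R] {M : Type} [AddCommGroup M]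
    [Module R M] :
    ∃ (Q : Type) (_ : AddCommGroup Q) (_ : Module R Q) (ψ : Q →ₗ[R] M),
      Module.Projective R Q ∧ Function.Surjective ψ ∧ ∀ T : Set R,
        (∀ x : ExtGrp R M 1, ∃ s ∈ T, s • x = 0) ↔ ExtendsUpTo T ψ := by
  let P := projectiveResolution (ModuleCat.of R M)
  let ψ : P.complex.X 0 ⟶ ModuleCat.of R M := P.π.f 0
  have hsurj : Function.Surjective ψ :=
    (ModuleCat.epi_iff_surjective ψ).1 (inferInstanceAs (Epi (P.π.f 0)))
  have hproj : Module.Projective R (P.complex.X 0) :=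
    (IsProjective.iff_projective (P.complex.X 0)).2 (P.projective 0)
  have h0 : ∀ q, ψ q = 0 → ∃ y, P.complex.d 1 0 y = q :=
    (ShortComplex.moduleCat_exact_iff _).1 P.exact₀
  have h0' : ∀ y, ψ (P.complex.d 1 0 y) = 0 := fun y ↦
    ConcreteCategory.congr_hom P.complex_d_comp_π_f_zero y
  have h1 : ∀ q, P.complex.d 1 0 q = 0 → ∃ y, P.complex.d 2 1 y = q :=
    (ShortComplex.moduleCat_exact_iff _).1 (P.exact_succ 0)
  have h1' : ∀ y, P.complex.d 1 0 (P.complex.d 2 1 y) = 0 := fun y ↦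
    ConcreteCategory.congr_hom (P.complex.d_comp_d 2 1 0) y
  refine ⟨P.complex.X 0, inferInstance, inferInstance, ψ.hom, hproj, hsurj, fun T ↦ ?_⟩
  rw [ExtGrp, moduleCat_forall_exists_smul_eq_zero_congr (P.isoExt 1 (ModuleCat.of R R)),
    moduleCat_forall_exists_smul_eq_zero_congr (HomologicalComplex.homologyIsoSc' _ 0 1 2
      (by simp) (by simp)), moduleCat_homology_forall_exists_smul_eq_zero_iff]
  change (∀ z : P.complex.X 1 ⟶ ModuleCat.of R R, P.complex.d 2 1 ≫ z = 0 → ∃ s ∈ T,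
    ∃ y : P.complex.X 0 ⟶ ModuleCat.of R R, P.complex.d 1 0 ≫ y = s • z) ↔ _
  let δ : P.complex.X 1 →ₗ[R] LinearMap.ker ψ.hom := (P.complex.d 1 0).hom.codRestrict _ h0'
  have hδ : Function.Surjective δ := fun k ↦ by
    obtain ⟨y, hy⟩ := h0 k k.2
    exact ⟨y, Subtype.ext hy⟩
  have hker : ∀ y, δ y = 0 → ∃ w, P.complex.d 2 1 w = y := fun y hy ↦
    h1 y (congrArg Subtype.val hy)
  refine ⟨fun h f ↦ ?_, fun h z hz ↦ ?_⟩
  · obtain ⟨s, hs, y, hy⟩ := h (ModuleCat.ofHom (f ∘ₗ δ)) (by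
      ext w
      change f (δ (P.complex.d 2 1 w)) = 0
      rw [show δ (P.complex.d 2 1 w) = 0 from Subtype.ext (h1' w), map_zero])
    refine ⟨s, hs, y.hom, fun k ↦ ?_⟩
    obtain ⟨w, rfl⟩ := hδ k
    exact ConcreteCategory.congr_hom hy w
  · have hle : LinearMap.ker δ ≤ LinearMap.ker z.hom := fun y hy ↦ by
      obtain ⟨w, rfl⟩ := hker y hy
      exact ConcreteCategory.congr_hom hz w
    let f : LinearMap.ker ψ.hom →ₗ[R] R :=
      (LinearMap.ker δ).liftQ z.hom hle ∘ₗ (δ.quotKerEquivOfSurjective hδ).symm.toLinearMap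
    have hf : ∀ w, f (δ w) = z w := fun w ↦ by
      have : (δ.quotKerEquivOfSurjective hδ).symm (δ w) = (LinearMap.ker δ).mkQ w :=
        (LinearEquiv.symm_apply_eq _).2 rfl
      change (LinearMap.ker δ).liftQ z.hom hle ((δ.quotKerEquivOfSurjective hδ).symm (δ w)) = _
      rw [this]
      rfl
    obtain ⟨s, hs, g, hg⟩ := h f
    refine ⟨s, hs, ModuleCat.ofHom g, ?_⟩
    ext w
    refine (hg (δ w)).trans ?_
    rw [hf]
    rfl

theorem exists_notMem_clear_denominators {Λ ι : Type*} [CommRing Λ] [Finite ι] (q : Ideal Λ)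
    [q.IsPrime] (f : ι → q.ResidueField) :
    ∃ d ∉ q, ∃ f' : ι → Λ, ∀ i, algebraMap Λ q.ResidueField (f' i) =
      algebraMap Λ q.ResidueField d * f i := by
  obtain ⟨b, hb⟩ := IsLocalization.exist_integer_multiples_of_finite
    (nonZeroDivisors (Λ ⧸ q)) f
  choose f₀ hf₀ using hb
  obtain ⟨d, hd⟩ := Ideal.Quotient.mk_surjective (b : Λ ⧸ q)
  choose f' hf' using fun i ↦ Ideal.Quotient.mk_surjective (f₀ i)
  refine ⟨d, fun h ↦ ?_, f', fun i ↦ ?_⟩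
  · exact nonZeroDivisors.coe_ne_zero b (by rw [← hd]; exact Ideal.Quotient.eq_zero_iff_mem.2 h)
  · rw [IsScalarTower.algebraMap_apply Λ (Λ ⧸ q) q.ResidueField,
      IsScalarTower.algebraMap_apply Λ (Λ ⧸ q) q.ResidueField, Ideal.Quotient.algebraMap_eq,
      hf', hd, hf₀, ← Algebra.smul_def]

open Matrix in
/-- A matrix whose reduction modulo a prime `q` is injective has a left inverse up to an
element outside `q`. -/
theorem exists_matrix_mul_eq_scalar {Λ m n : Type*} [CommRing Λ] [Fintype m] [Fintype n]
    [DecidableEq m] [DecidableEq n] (q : Ideal Λ) [q.IsPrime] (A : Matrix m n Λ)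
    (hA : ∀ v : n → Λ, (∀ i, (A *ᵥ v) i ∈ q) → ∀ j, v j ∈ q) :
    ∃ s ∉ q, ∃ B : Matrix n m Λ, B * A = s • (1 : Matrix n n Λ) := by
  let θ := algebraMap Λ q.ResidueField
  have hθ : ∀ x, θ x = 0 ↔ x ∈ q := fun x ↦ Ideal.algebraMap_residueField_eq_zero
  have hinj : LinearMap.ker (A.map θ).mulVecLin = ⊥ := by
    rw [LinearMap.ker_eq_bot']
    intro v hv
    obtain ⟨d, hd, v', hv'⟩ := exists_notMem_clear_denominators q v
    have hv'' : θ ∘ v' = θ d • v := funext hv'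
    have hq : ∀ j, v' j ∈ q := hA v' fun i ↦ by
      rw [← hθ, RingHom.map_mulVec, hv'', mulVec_smul]
      rw [mulVecLin_apply] at hv
      rw [hv]
      simp
    funext j
    have h := hv' j
    rw [(hθ _).2 (hq j), eq_comm] at h
    exact (mul_eq_zero.1 h).resolve_left (fun h ↦ hd ((hθ d).1 h))
  obtain ⟨g, hg⟩ := (A.map θ).mulVecLin.exists_leftInverse_of_injective hinj
  have hC : LinearMap.toMatrix' g * A.map θ = 1 := by
    rw [← LinearMap.toMatrix'_toLin' (A.map θ), ← LinearMap.toMatrix'_comp, toLin'_apply', hg,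
      LinearMap.toMatrix'_id]
  obtain ⟨d, hd, b, hb⟩ := exists_notMem_clear_denominators q
    (fun p : n × m ↦ LinearMap.toMatrix' g p.1 p.2)
  let B₀ : Matrix n m Λ := Matrix.of fun i j ↦ b (i, j)
  have hB₀ : B₀.map θ = θ d • LinearMap.toMatrix' g := by
    ext i j
    exact hb (i, j)
  have hdet : (B₀ * A).det ∉ q := by
    rw [← hθ, RingHom.map_det, RingHom.mapMatrix_apply, Matrix.map_mul, hB₀, Matrix.smul_mul, hC,
      det_smul, det_one, mul_one]
    exact pow_ne_zero _ fun h ↦ hd ((hθ d).1 h)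
  exact ⟨_, hdet, (B₀ * A).adjugate * B₀, by rw [Matrix.mul_assoc, adjugate_mul]⟩

theorem exists_colon_eq_of_heightLEOne {Λ : Type} [CommRing Λ] [IsNoetherianRing Λ] [IsDomain Λ]
    {q : Ideal Λ} (hq : q.IsPrime) (hht : HeightLEOne Λ q) :
    q = ⊥ ∨ ∃ a c : Λ, a ≠ 0 ∧ a ∈ q ∧ ∀ r, r ∈ q ↔ a ∣ r * c := by
  rw [or_iff_not_imp_left]
  intro hbot
  obtain ⟨a, ha, ha0⟩ := Submodule.exists_mem_ne_zero_of_ne_bot hbot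
  refine ⟨a, ?_⟩
  have hmin : q ∈ (Ideal.span {a}).minimalPrimes := by
    refine ⟨⟨hq, (Ideal.span_singleton_le_iff_mem _).2 ha⟩, fun p hp hpq ↦ ?_⟩
    by_contra hlt
    refine hht ⟨⊥, p, Ideal.isPrime_bot, hp.1, bot_lt_iff_ne_bot.2 ?_, lt_of_le_not_ge hpq hlt⟩
    rintro rfl
    exact ha0 (by simpa using hp.2)
  have hass := Module.associatedPrimes.minimalPrimes_annihilator_subset_associatedPrimes Λ
    (Λ ⧸ Ideal.span {a}) (by rwa [Ideal.annihilator_quotient])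
  obtain ⟨-, y, hy⟩ := isAssociatedPrime_iff.1 hass
  obtain ⟨c, rfl⟩ := Ideal.Quotient.mk_surjective y
  refine ⟨c, ha0, ha, fun r ↦ ?_⟩
  rw [hy, Submodule.mem_colon_singleton, Submodule.mem_bot, Algebra.smul_def,
    Ideal.Quotient.algebraMap_eq, ← map_mul, Ideal.Quotient.eq_zero_iff_mem,
    Ideal.mem_span_singleton]

/-- A saturated finite free submodule of a finite free module over a Noetherian domain is a direct
summand after localizing at a prime of height at most one. -/
theorem exists_retraction_up_to_of_heightLEOne {Λ : Type} [CommRing Λ] [IsNoetherianRing Λ]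
    [IsDomain Λ] {K F : Type*} [AddCommGroup K] [Module Λ K] [Module.Free Λ K] [Module.Finite Λ K]
    [AddCommGroup F] [Module Λ F] [Module.Free Λ F] [Module.Finite Λ F] (ι : K →ₗ[Λ] F)
    (hι : Function.Injective ι)
    (hsat : ∀ a : Λ, a ≠ 0 → ∀ y, a • y ∈ LinearMap.range ι → y ∈ LinearMap.range ι)
    {q : Ideal Λ} (hq : q.IsPrime) (hht : HeightLEOne Λ q) :
    ∃ s ∉ q, ∃ B : F →ₗ[Λ] K, ∀ k, B (ι k) = s • k := by
  classical
  let bK := Module.Free.chooseBasis Λ K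
  let bF := Module.Free.chooseBasis Λ F
  have hred : ∀ k, (∀ i, bF.repr (ι k) i ∈ q) → ∀ j, bK.repr k j ∈ q := by
    intro k hk j
    obtain rfl | ⟨a, c, ha, haq, hac⟩ := exists_colon_eq_of_heightLEOne hq hht
    · have : ι k = 0 := bF.repr.injective (Finsupp.ext fun i ↦ by simpa using hk i)
      rw [hι (this.trans (map_zero ι).symm)]
      simp
    · choose w hw using fun i ↦ (hac _).1 (hk i)
      have h1 : c • ι k = a • bF.equivFun.symm w := by
        apply bF.equivFun.injective
        ext i
        simp only [map_smul, LinearEquiv.apply_symm_apply, Pi.smul_apply, smul_eq_mul,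
          Module.Basis.equivFun_apply, ← hw, mul_comm]
      obtain ⟨k', hk'⟩ := hsat a ha (bF.equivFun.symm w)
        ⟨c • k, by rw [map_smul, h1]⟩
      have h2 : c • k = a • k' := hι (by rw [map_smul, h1, map_smul, hk'])
      rw [hac]
      refine ⟨bK.repr k' j, ?_⟩
      have := DFunLike.congr_fun (congrArg bK.repr h2) j
      simpa [mul_comm] using this
  obtain ⟨s, hs, B, hB⟩ := exists_matrix_mul_eq_scalar q (LinearMap.toMatrix bK bF ι)
    fun v hv j ↦ by
      have := hred (bK.equivFun.symm v) (fun i ↦ by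
        have h := LinearMap.toMatrix_mulVec_repr bK bF ι (bK.equivFun.symm v)
        rw [← h]
        have hrepr : ⇑(bK.repr (bK.equivFun.symm v)) = v := bK.equivFun.apply_symm_apply v
        rw [hrepr]
        exact hv i) j
      rwa [show bK.repr (bK.equivFun.symm v) j = v j from
        congrFun (bK.equivFun.apply_symm_apply v) j] at this
  refine ⟨s, hs, Matrix.toLin bF bK B, fun k ↦ ?_⟩
  have : Matrix.toLin bF bK B ∘ₗ ι = s • LinearMap.id := by
    conv_lhs => rw [← Matrix.toLin_toMatrix bK bF ι, ← Matrix.toLin_mul, hB]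
    rw [map_smul, Matrix.toLin_one]
  exact LinearMap.congr_fun this k

/-- Linear forms extend along a submodule of a module over a self-dual algebra, up to a scalar of
the base ring, as soon as the submodule is a retract over the base ring up to that scalar. -/
theorem SelfDualAlgebra.exists_extension {Λ 𝓡 : Type} [CommRing Λ] [CommRing 𝓡] [Algebra Λ 𝓡]
    (hdual : SelfDualAlgebra Λ 𝓡) {F : Type*} [AddCommGroup F] [Module Λ F] [Module 𝓡 F]
    [IsScalarTower Λ 𝓡 F] (K : Submodule 𝓡 F) {s : Λ} (B : F →ₗ[Λ] K)
    (hB : ∀ k : K, B k = s • k) (f : K →ₗ[𝓡] 𝓡) :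
    ∃ g : F →ₗ[𝓡] 𝓡, ∀ k : K, g k = algebraMap Λ 𝓡 s * f k := by
  obtain ⟨e, he⟩ := hdual
  have he' : ∀ r x, e.symm (r * x) = (e.symm x).comp (LinearMap.mulLeft Λ r) := fun r x ↦ by
    rw [LinearEquiv.symm_apply_eq, he, LinearEquiv.apply_symm_apply]
  let g₀ : K →ₗ[Λ] Λ := LinearMap.applyₗ 1 ∘ₗ e.symm.toLinearMap ∘ₗ f.restrictScalars Λ
  have hg₀ : ∀ (r : 𝓡) (k : K), g₀ (r • k) = e.symm (f k) r := fun r k ↦ by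
    change e.symm (f (r • k)) 1 = _
    rw [map_smul, smul_eq_mul, he']
    simp
  let ev : F → (𝓡 →ₗ[Λ] Λ) := fun y ↦
    g₀ ∘ₗ B ∘ₗ (LinearMap.toSpanSingleton 𝓡 F y).restrictScalars Λ
  have hev : ∀ y r, ev y r = g₀ (B (r • y)) := fun _ _ ↦ rfl
  refine ⟨{ toFun := fun y ↦ e (ev y), map_add' := fun x y ↦ ?_, map_smul' := fun r y ↦ ?_ },
    fun k ↦ ?_⟩
  · rw [← map_add]
    congr 1
    ext r
    simp [hev]
  · rw [RingHom.id_apply, smul_eq_mul, ← he]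
    congr 1
    ext t
    change ev (r • y) t = ev y (r * t)
    rw [hev, hev, smul_smul, mul_comm]
  · change e (ev k) = _
    rw [← Algebra.smul_def, ← LinearEquiv.eq_symm_apply, map_smul]
    ext r
    rw [hev, ← Submodule.coe_smul, hB, map_smul, hg₀]
    rfl

theorem extendsUpTo_of_torsionFree {Λ 𝓡 : Type} [CommRing Λ] [IsNoetherianRing Λ] [IsLocalRing Λ]
    [IsDomain Λ] [CommRing 𝓡] [Algebra Λ 𝓡] [Module.Free Λ 𝓡] [Module.Finite Λ 𝓡]
    (hdual : SelfDualAlgebra Λ 𝓡) {M : Type} [AddCommGroup M] [Module 𝓡 M] {n : ℕ}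
    (φ : (Fin n → 𝓡) →ₗ[𝓡] M) [Module.Projective 𝓡 (LinearMap.ker φ)]
    (hM : ∀ x : M, x ≠ 0 → ∀ a : Λ, a ≠ 0 → algebraMap Λ 𝓡 a • x ≠ 0)
    {q : Ideal Λ} (hq : q.IsPrime) (hht : HeightLEOne Λ q) :
    ExtendsUpTo (q.primeCompl.map (algebraMap Λ 𝓡)) φ := by
  have : IsNoetherian Λ (Fin n → 𝓡) := inferInstance
  have hfin : Module.Finite Λ (LinearMap.ker φ) :=
    Module.Finite.of_injective ((LinearMap.ker φ).subtype.restrictScalars Λ)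
      Subtype.val_injective
  have hflat : Module.Flat Λ (LinearMap.ker φ) := Module.Flat.trans Λ 𝓡 _
  have hfree : Module.Free Λ (LinearMap.ker φ) := Module.free_of_flat_of_isLocalRing
  obtain ⟨s, hs, B, hB⟩ := exists_retraction_up_to_of_heightLEOne
    ((LinearMap.ker φ).subtype.restrictScalars Λ) Subtype.val_injective (fun a ha y hy ↦ by
      obtain ⟨k, hk⟩ := hy
      refine ⟨⟨y, ?_⟩, rfl⟩
      by_contra hy0
      refine hM (φ y) hy0 a ha ?_
      rw [← map_smul, algebraMap_smul, ← hk]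
      exact k.2) hq hht
  intro f
  obtain ⟨g, hg⟩ := hdual.exists_extension _ B hB f
  exact ⟨_, ⟨s, hs, rfl⟩, g, hg⟩

theorem torsionFree_of_extendsUpTo {Λ 𝓡 : Type} [CommRing Λ] [IsNoetherianRing Λ] [IsLocalRing Λ]
    [IsDomain Λ] (hΛ : ColonPrimesHeightLEOne Λ)
    [CommRing 𝓡] [Algebra Λ 𝓡] [Module.Free Λ 𝓡] [Module.Finite Λ 𝓡]
    {M : Type} [AddCommGroup M] [Module 𝓡 M] {n : ℕ}
    (φ : (Fin n → 𝓡) →ₗ[𝓡] M) (hφ : Function.Surjective φ)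
    [Module.Projective 𝓡 (LinearMap.ker φ)]
    (h : ∀ (q : Ideal Λ) [q.IsPrime], HeightLEOne Λ q →
      ExtendsUpTo (q.primeCompl.map (algebraMap Λ 𝓡)) φ)
    (x : M) (hx : x ≠ 0) (a : Λ) (ha : a ≠ 0) : algebraMap Λ 𝓡 a • x ≠ 0 := by
  intro hax
  have : IsNoetherianRing 𝓡 := IsNoetherianRing.of_finite Λ 𝓡
  have hfin : Module.Finite Λ (LinearMap.ker φ) :=
    Module.Finite.of_injective ((LinearMap.ker φ).subtype.restrictScalars Λ)
      Subtype.val_injective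
  have hflat : Module.Flat Λ (LinearMap.ker φ) := Module.Flat.trans Λ 𝓡 _
  have hfree : Module.Free Λ (LinearMap.ker φ) := Module.free_of_flat_of_isLocalRing
  let b := Module.Free.chooseBasis Λ (LinearMap.ker φ)
  obtain ⟨y, rfl⟩ := hφ x
  let z : LinearMap.ker φ := ⟨a • y, by
    rw [LinearMap.mem_ker, ← algebraMap_smul 𝓡 a y, map_smul, hax]⟩
  obtain ⟨i, hi⟩ : ∃ i, ¬ a ∣ b.repr z i := by
    by_contra! hdvd
    choose w hw using hdvd
    have hz : z = a • b.equivFun.symm w := by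
      apply b.equivFun.injective
      rw [map_smul, LinearEquiv.apply_symm_apply]
      exact funext hw
    have hy : y = (b.equivFun.symm w : LinearMap.ker φ) :=
      smul_right_injective (Fin n → 𝓡) ha (congrArg Subtype.val hz)
    exact hx (by rw [hy]; exact (b.equivFun.symm w).2)
  obtain ⟨q, hq, ⟨c, hc⟩, hle⟩ := exists_prime_colon_of_not_dvd hi
  obtain ⟨_, ⟨s, hs, rfl⟩, B, hB⟩ :=
    (h q (heightLEOne_of_height_le_one (hΛ a c ha q hq hc))).exists_retraction
  refine hs (hle s ⟨b.repr (B y) i, ?_⟩)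
  have h1 : s • z = a • B y := by
    rw [← algebraMap_smul 𝓡 s z, ← hB z, ← algebraMap_smul 𝓡 a (B y), ← map_smul, algebraMap_smul]
  simpa using DFunLike.congr_fun (congrArg b.repr h1) i

/-- Let `Λ` be a commutative Noetherian regular local ring and `𝓡` a commutative
`Λ`-algebra, free of finite rank as a `Λ`-module, with `Hom_Λ(𝓡, Λ) ≅ 𝓡` as
`𝓡`-modules.  Let `M` be a finitely generated `𝓡`-module with `pd_𝓡(M) ≤ 1` and put
`N = E¹(M) = Ext¹_𝓡(M, 𝓡)`.  Then `M` is torsion-free (no nonzero element of `M` is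
annihilated by a nonzero element of `Λ`) if and only if `N` is pseudo-null. -/
theorem torsionFree_iff_ext_pseudoNull
    (Λ 𝓡 : Type) [CommRing Λ] [IsNoetherianRing Λ] [IsLocalRing Λ]
    (hreg : IsRegularLocal Λ)
    [CommRing 𝓡] [Algebra Λ 𝓡] [Module.Free Λ 𝓡] [Module.Finite Λ 𝓡]
    (hdual : SelfDualAlgebra Λ 𝓡)
    (M : Type) [AddCommGroup M] [Module 𝓡 M] [Module.Finite 𝓡 M]
    (hpd : ProjDimLEOne 𝓡 M) :
    (∀ x : M, x ≠ 0 → ∀ a : Λ, a ≠ 0 → algebraMap Λ 𝓡 a • x ≠ 0) ↔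
      IsPseudoNull Λ (𝓡 := 𝓡) ↥(ExtGrp 𝓡 M 1) := by
  obtain ⟨s, hs, hcard⟩ := hreg
  obtain ⟨hdom, hΛ⟩ := isDomain_and_colonPrimes_of_span_eq_maximalIdeal s.card Λ s hs le_rfl
    hcard.le
  obtain ⟨n, φ, hφ, hproj⟩ := hpd
  obtain ⟨Q, _, _, ψ, hQ, hψ, hExt⟩ := exists_extendsUpTo_iff_ext_one (R := 𝓡) (M := M)
  have key : ∀ (q : Ideal Λ) [q.IsPrime], ExtendsUpTo (q.primeCompl.map (algebraMap Λ 𝓡)) φ ↔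
      ∀ x : ExtGrp 𝓡 M 1, ∃ s : Λ, s ∉ q ∧ algebraMap Λ 𝓡 s • x = 0 := by
    intro q _
    have h := hExt (q.primeCompl.map (algebraMap Λ 𝓡))
    refine Iff.trans ⟨.of_surjective hφ hψ, .of_surjective hψ hφ⟩ (h.symm.trans ?_)
    refine forall_congr' fun x ↦ ⟨?_, ?_⟩
    · rintro ⟨_, ⟨s, hs, rfl⟩, h0⟩
      exact ⟨s, hs, h0⟩
    · rintro ⟨s, hs, h0⟩
      exact ⟨_, ⟨s, hs, rfl⟩, h0⟩
  refine ⟨fun hM q hq hht ↦ (key q).1 (extendsUpTo_of_torsionFree hdual φ hM hq hht), fun h ↦ ?_⟩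
  exact torsionFree_of_extendsUpTo hΛ φ hφ fun q hq hht ↦ (key q).2 (h q hq hht)
end
end
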